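/- arXiv:1509.02591 — 6 statements merged into one kernel-verified Lean document; each statement's English description precedes it below -/
import Mathlib

section
/- Let f : T² → T² be the hyperbolic toral automorphism f(x,y) = (2x+y, x+y), and let F̃ˢ denote the closure, in the hyperspace (C(T²), dist_H), of the set C(Fˢ) of continua contained in a single stable leaf of f. Then for every stable arc Aˢ = A(x,L) with L > 0 one has dist_{H²}(i(f^{-n}(Aˢ)), F̃ˢ) → 0 as n → +∞; that is, the negative iterates of any nontrivial stable arc converge, in the second order Hausdorff distance, to the hypercontinuum associated with the stable foliation. -/
open Metric Set Filter TopologicalSpace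

instance : Fact ((0:ℝ) < 1) := ⟨zero_lt_one⟩

/-- The flat torus T² = (ℝ/ℤ) × (ℝ/ℤ). -/
abbrev T2 : Type := AddCircle (1:ℝ) × AddCircle (1:ℝ)

/-- The quotient map π : ℝ² → T². -/
noncomputable def pr (p : ℝ × ℝ) : T2 := (↑p.1, ↑p.2)

/-- The hyperbolic toral automorphism f(x,y) = (2x+y, x+y). -/
noncomputable def fA (p : T2) : T2 := (p.1 + p.1 + p.2, p.1 + p.2)

/-- The stable eigenvector v = (1, -(1+√5)/2) of [[2,1],[1,1]]. -/
noncomputable def vs : ℝ × ℝ := (1, -((1 + Real.sqrt 5) / 2))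

/-- The stable arc A(x,L) = {x + π(t·v) : t ∈ [0,L]}. -/
noncomputable def stArc (x : T2) (L : ℝ) : Set T2 := (fun t : ℝ => x + pr (t • vs)) '' Icc 0 L

/-- The stable leaf through x. -/
noncomputable def stLeaf (x : T2) : Set T2 := range fun t : ℝ => x + pr (t • vs)

/-- The hyperspace of continua (nonempty compact connected subsets) of `X`,
with the Hausdorff distance as its metric. -/
abbrev Continua (X : Type*) [MetricSpace X] :=
  {K : TopologicalSpace.NonemptyCompacts X // IsConnected (K : Set X)}

/-- C(Fˢ): the continua of T² contained in a single stable leaf. -/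
noncomputable def CFs : Set (Continua T2) := {A | ∃ x : T2, (A.1 : Set T2) ⊆ stLeaf x}

/-- Boundary bumping: a component of the trace of a continuum `K` on the closure of an open set `U`
not containing `K` reaches the complement of `U`. -/
theorem exists_isPreconnected_subset_inter_closure {Y : Type*} [TopologicalSpace Y] [T2Space Y]
    {K U : Set Y} (hK : IsCompact K) (hKc : IsPreconnected K) (hU : IsOpen U) (hKU : ¬ K ⊆ U)
    {y : Y} (hyK : y ∈ K) (hyU : y ∈ U) :
    ∃ C ⊆ K ∩ closure U, IsCompact C ∧ IsPreconnected C ∧ y ∈ C ∧ (C \ U).Nonempty := by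
  set E : Set Y := K ∩ closure U
  have hEc : IsCompact E := hK.inter_right isClosed_closure
  have : CompactSpace E := isCompact_iff_compactSpace.mp hEc
  have hyE : y ∈ E := ⟨hyK, subset_closure hyU⟩
  refine ⟨(↑) '' connectedComponent (⟨y, hyE⟩ : E), by rintro _ ⟨z, -, rfl⟩; exact z.2,
    isClosed_connectedComponent.isCompact.image continuous_subtype_val,
    isPreconnected_connectedComponent.image _ continuous_subtype_val.continuousOn,
    ⟨_, mem_connectedComponent, rfl⟩, ?_⟩
  by_contra hne
  rw [not_nonempty_iff_eq_empty, sdiff_eq_empty, image_subset_iff,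
    connectedComponent_eq_iInter_isClopen] at hne
  have : Nonempty {s : Set E // IsClopen s ∧ (⟨y, hyE⟩ : E) ∈ s} :=
    ⟨⟨univ, isClopen_univ, mem_univ _⟩⟩
  obtain ⟨⟨Q, hQ, hyQ⟩, hQU⟩ := exists_subset_nhds_of_compactSpace
    (V := fun s : {s : Set E // IsClopen s ∧ (⟨y, hyE⟩ : E) ∈ s} => (s : Set E))
    (fun s t => ⟨⟨s.1 ∩ t.1, s.2.1.inter t.2.1, s.2.2, t.2.2⟩, inter_subset_left,
      inter_subset_right⟩) (fun s => s.2.1.isClosed) (U := (↑) ⁻¹' U)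
    (fun z hz => (hU.preimage continuous_subtype_val).mem_nhds (hne hz))
  obtain ⟨W, hW, rfl⟩ := isOpen_induced_iff.mp hQ.isOpen
  have hcl : IsClosed ((↑) '' ((↑) ⁻¹' W : Set E) : Set Y) :=
    (hQ.isClosed.isCompact.image continuous_subtype_val).isClosed
  have hQimg : ((↑) '' ((↑) ⁻¹' W : Set E) : Set Y) = E ∩ W := Subtype.image_preimage_coe E W
  rw [hQimg] at hcl
  refine hKU (Subset.trans ?_ (inter_subset_right (s := W)))
  refine (isPreconnected_iff_subset_of_disjoint.mp hKc (W ∩ U) (E ∩ W)ᶜ (hW.inter hU)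
    hcl.isOpen_compl (fun z hz => ?_) ?_).resolve_right fun h => h hyK ⟨hyE, hyQ⟩
  · by_cases h : z ∈ E ∩ W
    · exact Or.inl ⟨h.2, hQU (a := ⟨z, h.1⟩) h.2⟩
    · exact Or.inr h
  · rw [eq_empty_iff_forall_notMem]
    rintro z ⟨hz, ⟨hzW, hzU⟩, hn⟩
    exact hn ⟨⟨hz, subset_closure hzU⟩, hzW⟩

/-- Sierpiński's theorem: a continuum covered by a sequence of pairwise disjoint closed sets lies in
one of them. -/
theorem IsConnected.exists_subset_of_subset_iUnion_isClosed {Y : Type*} [TopologicalSpace Y]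
    [T2Space Y] {X : ℕ → Set Y} (hX : ∀ i, IsClosed (X i))
    (hd : ∀ i j y, y ∈ X i → y ∈ X j → i = j) {K : Set Y} (hK : IsCompact K) (hKc : IsConnected K)
    (hKX : K ⊆ ⋃ i, X i) : ∃ i, K ⊆ X i := by
  by_contra! hcon
  let P : Set Y → Prop := fun C => IsCompact C ∧ IsConnected C ∧ C ⊆ K ∧ ∀ i, ¬ C ⊆ X i
  have step : ∀ (i : ℕ) (C : {C // P C}), ∃ C' : {C // P C},
      (C' : Set Y) ⊆ C ∧ Disjoint (C' : Set Y) (X i) := by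
    rintro i ⟨C, hC, hCc, hCK, hCX⟩
    rcases (C ∩ X i).eq_empty_or_nonempty with h | ⟨a, haC, hai⟩
    · exact ⟨⟨C, hC, hCc, hCK, hCX⟩, Subset.rfl, disjoint_iff_inter_eq_empty.mpr h⟩
    obtain ⟨y, hyC, hyi⟩ := not_subset.mp (hCX i)
    obtain ⟨j, hyj⟩ := mem_iUnion.mp (hKX (hCK hyC))
    obtain ⟨U, V, hU, hV, hUj, hVi, hUV⟩ := SeparatedNhds.of_isCompact_isCompact
      (hC.inter_right (hX j)) (hC.inter_right (hX i)) (by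
        rw [Set.disjoint_left]
        rintro z ⟨-, hz⟩ ⟨-, hz'⟩
        exact hyi (hd _ _ z hz hz' ▸ hyj))
    obtain ⟨D, hDC, hD, hDc, hyD, z, hzD, hzU⟩ := exists_isPreconnected_subset_inter_closure hC
      hCc.isPreconnected hU (fun h => Set.disjoint_left.mp hUV (h haC) (hVi ⟨haC, hai⟩)) hyC
      (hUj ⟨hyC, hyj⟩)
    refine ⟨⟨D, hD, ⟨⟨y, hyD⟩, hDc⟩, fun w hw => hCK (hDC hw).1, fun k hk => hzU ?_⟩,
      fun w hw => (hDC hw).1, ?_⟩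
    · have := hd _ _ y (hk hyD) hyj
      subst this
      exact hUj ⟨(hDC hzD).1, hk hzD⟩
    · rw [Set.disjoint_left]
      intro w hw hwi
      exact Set.disjoint_left.mp (hUV.closure_left hV) (hDC hw).2 (hVi ⟨(hDC hw).1, hwi⟩)
  choose F hFsub hFdisj using step
  let T : ℕ → {C // P C} := fun n => Nat.rec ⟨K, hK, hKc, Subset.rfl, hcon⟩ (fun n C => F n C) n
  have hcl : ∀ n, IsClosed (T n).1 := fun n => (T n).2.1.isClosed
  obtain ⟨y, hy⟩ := IsCompact.nonempty_iInter_of_sequence_nonempty_isCompact_isClosed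
    (fun n => (T n).1) (fun n => hFsub n (T n)) (fun n => (T n).2.2.1.nonempty) hK hcl
  rw [mem_iInter] at hy
  obtain ⟨i, hi⟩ := mem_iUnion.mp (hKX (hy 0))
  exact Set.disjoint_left.mp (hFdisj i (T i)) (hy (i + 1)) hi

/-- A continuum in an injectively immersed line either contains the image of a half-line or is
the image of a compact interval. -/
theorem IsConnected.image_Ici_subset_or_eq_image_Icc {Y : Type*} [TopologicalSpace Y] [T2Space Y]
    {g : ℝ → Y} (hg : Continuous g) (hinj : Function.Injective g) {K : Set Y} (hK : IsCompact K)
    (hKc : IsConnected K) (hKg : K ⊆ range g) :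
    (∃ a, g '' Ici a ⊆ K) ∨ (∃ a, g '' Iic a ⊆ K) ∨ ∃ a b, a ≤ b ∧ K = g '' Icc a b := by
  by_cases h1 : ∃ a, g '' Ici a ⊆ K
  · exact Or.inl h1
  by_cases h2 : ∃ a, g '' Iic a ⊆ K
  · exact Or.inr (Or.inl h2)
  refine Or.inr (Or.inr ?_)
  have hc : ∀ k : ℕ, ∃ c : ℝ, (k : ℝ) ≤ c ∧ g c ∉ K := by
    intro k
    by_contra! h
    exact h1 ⟨k, by rintro _ ⟨c, hc, rfl⟩; exact h c hc⟩
  have hd : ∀ k : ℕ, ∃ d : ℝ, d ≤ -(k : ℝ) ∧ g d ∉ K := by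
    intro k
    by_contra! h
    exact h2 ⟨-k, by rintro _ ⟨c, hc, rfl⟩; exact h c hc⟩
  choose c hck hcK using hc
  choose d hdk hdK using hd
  have hT : IsClosed (g ⁻¹' K) := hK.isClosed.preimage hg
  have hcov : K ⊆ ⋃ k,
      g '' (g ⁻¹' K ∩ Icc (d k) (c k) ∩ ⋂ i, ⋂ (_ : i < k), (Ioo (d i) (c i))ᶜ) := by
    intro y hy
    obtain ⟨t, rfl⟩ := hKg hy
    classical
    have hex : ∃ k : ℕ, t ∈ Icc (d k) (c k) := by
      obtain ⟨k, hk⟩ := exists_nat_ge |t|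
      exact ⟨k, (hdk k).trans (neg_le.mp ((neg_le_abs t).trans hk)),
        (le_abs_self t).trans (hk.trans (hck k))⟩
    refine mem_iUnion.mpr ⟨Nat.find hex, t, ⟨⟨hy, Nat.find_spec hex⟩, ?_⟩, rfl⟩
    simp only [mem_iInter]
    exact fun i hi hti => Nat.find_min hex hi (Ioo_subset_Icc_self hti)
  have hlt : ∀ i j t, t ∈ g ⁻¹' K ∩ Icc (d i) (c i) ∩ ⋂ l, ⋂ (_ : l < i), (Ioo (d l) (c l))ᶜ →
      t ∈ g ⁻¹' K ∩ Icc (d j) (c j) ∩ ⋂ l, ⋂ (_ : l < j), (Ioo (d l) (c l))ᶜ → ¬ i < j := by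
    rintro i j t ⟨⟨htK, hti, hti'⟩, -⟩ ⟨-, ht⟩ hij
    simp only [mem_iInter] at ht
    refine ht i hij ⟨lt_of_le_of_ne hti ?_, lt_of_le_of_ne hti' ?_⟩
    · rintro rfl; exact hdK i htK
    · rintro rfl; exact hcK i htK
  obtain ⟨k, hk⟩ := hKc.exists_subset_of_subset_iUnion_isClosed (X := fun k =>
      g '' (g ⁻¹' K ∩ Icc (d k) (c k) ∩ ⋂ i, ⋂ (_ : i < k), (Ioo (d i) (c i))ᶜ))
    (fun k => IsCompact.isClosed <| IsCompact.image ((isCompact_Icc.inter_left hT).inter_right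
      (isClosed_iInter fun i => isClosed_iInter fun _ => isOpen_Ioo.isClosed_compl)) hg)
    (by
      rintro i j _ ⟨t, ht, rfl⟩ ⟨s, hs, hst⟩
      obtain rfl := hinj hst
      exact le_antisymm (not_lt.mp (hlt j i s hs ht)) (not_lt.mp (hlt i j s ht hs))) hK hcov
  have hKI : K ⊆ g '' Icc (d k) (c k) := hk.trans (image_mono fun t ht => ht.1.2)
  have hcm : IsClosedMap (fun t : Icc (d k) (c k) => g t) :=
    (hg.comp continuous_subtype_val).isClosedMap
  have hconn := hKc.preimage_of_isClosedMap (f := fun t : Icc (d k) (c k) => g t)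
    (hinj.comp Subtype.val_injective) hcm
    (fun y hy => by obtain ⟨t, ht, rfl⟩ := hKI hy; exact ⟨⟨t, ht⟩, rfl⟩)
  have hconn' := hconn.image _ continuous_subtype_val.continuousOn
  have hcomp := ((hK.isClosed.preimage (hg.comp continuous_subtype_val)).isCompact
    (X := Icc (d k) (c k))).image continuous_subtype_val
  have heq := eq_Icc_of_connected_compact hconn' hcomp
  set a := sInf ((↑) '' ((fun t : Icc (d k) (c k) => g t) ⁻¹' K) : Set ℝ)
  set b := sSup ((↑) '' ((fun t : Icc (d k) (c k) => g t) ⁻¹' K) : Set ℝ)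
  refine ⟨a, b, nonempty_Icc.mp (heq ▸ hconn'.nonempty), ?_⟩
  rw [← heq]
  refine Subset.antisymm (fun y hy => ?_) ?_
  · obtain ⟨t, ht, rfl⟩ := hKI hy
    exact ⟨t, ⟨⟨t, ht⟩, hy, rfl⟩, rfl⟩
  · rintro _ ⟨_, ⟨t, ht, rfl⟩, rfl⟩
    exact ht

theorem pr_add (p q : ℝ × ℝ) : pr (p + q) = pr p + pr q := by
  simp [pr]

theorem continuous_pr : Continuous pr :=
  ((AddCircle.continuous_mk' 1).comp continuous_fst).prodMk
    ((AddCircle.continuous_mk' 1).comp continuous_snd)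

theorem continuous_leaf_param (x : T2) : Continuous fun t : ℝ => x + pr (t • vs) :=
  continuous_const.add (continuous_pr.comp (continuous_id.smul continuous_const))

theorem vs_eq : vs = (1, -Real.goldenRatio) := rfl

theorem injective_leaf_param (x : T2) : Function.Injective fun t : ℝ => x + pr (t • vs) := by
  intro t s h
  have h' : pr (t • vs) = pr (s • vs) := add_left_cancel h
  simp only [pr, vs_eq, Prod.smul_mk, smul_eq_mul, mul_one, Prod.mk.injEq] at h'
  obtain ⟨h1, h2⟩ := h'
  rw [← sub_eq_zero, ← AddCircle.coe_sub, AddCircle.coe_eq_zero_iff] at h1 h2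
  obtain ⟨m, hm⟩ := h1
  obtain ⟨n, hn⟩ := h2
  simp only [zsmul_eq_mul, mul_one] at hm hn
  by_contra hts
  have hm0 : (m : ℝ) ≠ 0 := by rw [hm]; exact sub_ne_zero.mpr hts
  refine Real.goldenRatio_irrational ⟨-n / m, ?_⟩
  push_cast
  rw [div_eq_iff hm0, hm, hn]
  ring

/-- Long enough stable arcs are uniformly dense. -/
theorem exists_length_forall_exists_dist_le {ε : ℝ} (hε : 0 < ε) :
    ∃ R : ℝ, 0 ≤ R ∧ ∀ y z : T2, ∃ s ∈ Icc 0 R, dist (y + pr (s • vs)) z ≤ ε := by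
  set a : AddCircle (1 : ℝ) := ((-Real.goldenRatio : ℝ) : AddCircle (1 : ℝ)) with ha
  have hdense : DenseRange (fun n : ℕ => n • a) := by
    rw [← denseRange_zsmul_iff_nsmul, ha, AddCircle.denseRange_zsmul_coe_iff, div_one]
    exact Real.goldenRatio_irrational.neg
  obtain ⟨F, hF⟩ := isCompact_univ.elim_finite_subcover (fun n : ℕ => ball (n • a) ε)
    (fun n => isOpen_ball) (fun z _ => by
      obtain ⟨n, hn⟩ := hdense.exists_dist_lt z hε
      exact mem_iUnion.mpr ⟨n, hn⟩)
  refine ⟨F.sup id + 1, by positivity, fun y z => ?_⟩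
  obtain ⟨t, ht, htz⟩ : ∃ t ∈ Ico (0 : ℝ) 1, (t : AddCircle (1 : ℝ)) = (z - y).1 := by
    have := AddCircle.coe_image_Ico_eq (1 : ℝ) 0
    rw [zero_add] at this
    obtain ⟨t, ht, h⟩ := this.ge (mem_univ (z - y).1)
    exact ⟨t, ht, h⟩
  obtain ⟨n, hnF, hn⟩ : ∃ n ∈ F, dist (n • a) ((z - y).2 - ((t * -Real.goldenRatio : ℝ) :
      AddCircle (1 : ℝ))) ≤ ε := by
    obtain ⟨n, hnF, hn⟩ := mem_iUnion₂.mp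
      (hF (mem_univ ((z - y).2 - ((t * -Real.goldenRatio : ℝ) : AddCircle (1 : ℝ)))))
    exact ⟨n, hnF, (dist_comm _ _).trans_le (mem_ball.mp hn).le⟩
  have hnR : (n : ℝ) ≤ (F.sup id : ℕ) := Nat.cast_le.mpr (Finset.le_sup (f := id) hnF)
  refine ⟨t + n, ⟨add_nonneg ht.1 n.cast_nonneg, by linarith [ht.2]⟩, ?_⟩
  have h1 : (pr ((t + n) • vs)).1 = (z - y).1 := by
    simp [pr, vs_eq, htz]
    exact ⟨n, by simp⟩
  have h2 : (pr ((t + n) • vs)).2 = n • a + ((t * -Real.goldenRatio : ℝ) : AddCircle (1 : ℝ)) := by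
    rw [ha, ← AddCircle.coe_nsmul, ← AddCircle.coe_add]
    simp only [pr, vs_eq, Prod.smul_mk, smul_eq_mul, nsmul_eq_mul]
    congr 1
    ring
  have h3 : dist (y + pr ((t + n) • vs)) z = dist (pr ((t + n) • vs)) (z - y) := by
    rw [← dist_add_left y (pr ((t + n) • vs)), add_sub_cancel]
  rw [h3, Prod.dist_eq, h1, dist_self, h2]
  refine max_le hε.le ?_
  rwa [← dist_add_right _ _ ((t * -Real.goldenRatio : ℝ) : AddCircle (1 : ℝ)), sub_add_cancel] at hn

theorem stArc_add (x : T2) (s L : ℝ) :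
    stArc (x + pr (s • vs)) L = (fun t : ℝ => x + pr (t • vs)) '' Icc s (s + L) := by
  have h : Icc s (s + L) = (fun t => s + t) '' Icc 0 L := by simp [add_comm]
  rw [h, image_image]
  simp only [stArc, add_smul, pr_add, add_assoc]

theorem isCompact_stArc (x : T2) (L : ℝ) : IsCompact (stArc x L) :=
  isCompact_Icc.image (continuous_leaf_param x)

theorem isConnected_stArc (x : T2) {L : ℝ} (hL : 0 ≤ L) : IsConnected (stArc x L) :=
  (isConnected_Icc hL).image _ (continuous_leaf_param x).continuousOn

/-- A continuum in a stable leaf is the whole torus or a stable arc. -/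
theorem eq_univ_or_eq_stArc_of_subset_stLeaf {K : Set T2} (hK : IsCompact K) (hKc : IsConnected K)
    {x : T2} (hKx : K ⊆ stLeaf x) : K = univ ∨ ∃ y L, 0 ≤ L ∧ K = stArc y L := by
  have huniv : ∀ h : ∀ R : ℝ, ∃ a, (fun t : ℝ => x + pr (t • vs)) '' Icc a (a + R) ⊆ K,
      K = univ := by
    intro h
    refine eq_univ_of_forall fun z => hK.isClosed.closure_subset ?_
    rw [Metric.mem_closure_iff]
    intro ε hε
    obtain ⟨R, -, hR⟩ := exists_length_forall_exists_dist_le (half_pos hε)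
    obtain ⟨a, ha⟩ := h R
    obtain ⟨s, hs, hsz⟩ := hR (x + pr (a • vs)) z
    rw [← stArc_add] at ha
    exact ⟨_, ha ⟨s, hs, rfl⟩, by rw [dist_comm]; linarith⟩
  rcases hKc.image_Ici_subset_or_eq_image_Icc (continuous_leaf_param x) (injective_leaf_param x) hK
    hKx with ⟨a, ha⟩ | ⟨a, ha⟩ | ⟨a, b, hab, rfl⟩
  · exact Or.inl (huniv fun R => ⟨a, (image_mono Icc_subset_Ici_self).trans ha⟩)
  · exact Or.inl (huniv fun R => ⟨a - R, (image_mono fun t ht => by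
      have := ht.2; rw [sub_add_cancel] at this; exact this).trans ha⟩)
  · exact Or.inr ⟨x + pr (a • vs), b - a, sub_nonneg.mpr hab, by rw [stArc_add, add_sub_cancel]⟩

/-- The inverse automorphism `(x, y) ↦ (x - y, -x + 2y)`. -/
noncomputable def fAInv (p : T2) : T2 := (p.1 - p.2, p.2 + p.2 - p.1)

theorem fA_eq_iff {p q : T2} : fA p = q ↔ p = fAInv q := by
  constructor
  · rintro rfl
    simp only [fA, fAInv]
    ext <;> dsimp only <;> abel
  · rintro rfl
    simp only [fA, fAInv]
    ext <;> dsimp only <;> abel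

theorem fAInv_add (p q : T2) : fAInv (p + q) = fAInv p + fAInv q := by
  ext <;> simp only [fAInv, Prod.fst_add, Prod.snd_add] <;> abel

/-- The inverse automorphism expands the stable direction by `φ + 1`. -/
theorem fAInv_pr_smul_vs (t : ℝ) :
    fAInv (pr (t • vs)) = pr (((Real.goldenRatio + 1) * t) • vs) := by
  simp only [fAInv, pr, vs_eq, Prod.smul_mk, smul_eq_mul, ← AddCircle.coe_add, ← AddCircle.coe_sub]
  have h := Real.goldenRatio_sq
  ext
  · dsimp only; congr 1; ring
  · dsimp only; congr 1; linear_combination t * h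

theorem preimage_fA_stArc (x : T2) (L : ℝ) :
    fA ⁻¹' stArc x L = stArc (fAInv x) ((Real.goldenRatio + 1) * L) := by
  have hφ : 0 < Real.goldenRatio + 1 := by linarith [Real.goldenRatio_pos]
  ext p
  constructor
  · rintro ⟨t, ht, h⟩
    refine ⟨(Real.goldenRatio + 1) * t,
      ⟨mul_nonneg hφ.le ht.1, mul_le_mul_of_nonneg_left ht.2 hφ.le⟩, ?_⟩
    dsimp only at h ⊢
    rw [fA_eq_iff.mp h.symm, fAInv_add, fAInv_pr_smul_vs]
  · rintro ⟨t, ht, rfl⟩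
    refine ⟨t / (Real.goldenRatio + 1),
      ⟨div_nonneg ht.1 hφ.le, (div_le_iff₀' hφ).mpr ht.2⟩, ?_⟩
    refine (fA_eq_iff.mpr ?_).symm
    rw [fAInv_add, fAInv_pr_smul_vs, mul_div_cancel₀ _ hφ.ne']

theorem exists_preimage_iterate_fA_stArc (x : T2) (L : ℝ) (n : ℕ) :
    ∃ y, fA^[n] ⁻¹' stArc x L = stArc y ((Real.goldenRatio + 1) ^ n * L) := by
  induction n with
  | zero => exact ⟨x, by simp⟩
  | succ n ih =>
    obtain ⟨y, hy⟩ := ih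
    exact ⟨fAInv y, by
      rw [Function.iterate_succ, preimage_comp, hy, preimage_fA_stArc, pow_succ', mul_assoc]⟩

theorem stArc_subset_stArc (y : T2) {s ℓ L : ℝ} (hs : 0 ≤ s) (hL : s + ℓ ≤ L) :
    stArc (y + pr (s • vs)) ℓ ⊆ stArc y L := by
  rw [stArc_add]
  exact image_mono (Icc_subset_Icc hs hL)

/-- Every continuum in a stable leaf is uniformly approximated by subcontinua of a long enough
stable arc. -/
theorem exists_length_forall_mem_CFs_exists_dist_le {ε : ℝ} (hε : 0 < ε) :
    ∃ R : ℝ, ∀ L ≥ R, ∀ y : T2, ∀ A ∈ CFs, ∃ B : Continua T2,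
      (B.1 : Set T2) ⊆ stArc y L ∧ dist A B ≤ ε := by
  obtain ⟨R, hR0, hR⟩ := exists_length_forall_exists_dist_le hε
  refine ⟨R + R, fun L hL y A hA => ?_⟩
  have hL0 : 0 ≤ L := by linarith
  have hdist : ∀ (z : T2) (ℓ : ℝ) (hℓ : 0 ≤ ℓ), stArc z ℓ ⊆ stArc y L →
      hausdorffDist (A.1 : Set T2) (stArc z ℓ) ≤ ε → ∃ B : Continua T2,
        (B.1 : Set T2) ⊆ stArc y L ∧ dist A B ≤ ε := fun z ℓ hℓ hsub hd =>
    ⟨⟨⟨⟨stArc z ℓ, isCompact_stArc z ℓ⟩, (isConnected_stArc z hℓ).nonempty⟩,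
      isConnected_stArc z hℓ⟩, hsub, hd⟩
  have hlong : (∀ z, ∃ w ∈ (A.1 : Set T2), dist w z ≤ ε) → ∃ B : Continua T2,
      (B.1 : Set T2) ⊆ stArc y L ∧ dist A B ≤ ε := fun h =>
    hdist y L hL0 Subset.rfl <| hausdorffDist_le_of_mem_dist hε.le
      (fun z _ => by
        obtain ⟨s, hs, hsz⟩ := hR y z
        exact ⟨_, ⟨s, ⟨hs.1, by linarith [hs.2]⟩, rfl⟩, by rwa [dist_comm]⟩)
      (fun z _ => by
        obtain ⟨w, hw, hwz⟩ := h z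
        exact ⟨w, hw, by rwa [dist_comm]⟩)
  obtain ⟨x, hx⟩ := hA
  rcases eq_univ_or_eq_stArc_of_subset_stLeaf A.1.isCompact A.2 hx with h | ⟨z, ℓ, hℓ, h⟩
  · exact hlong fun z => ⟨z, h ▸ mem_univ z, by rw [dist_self]; exact hε.le⟩
  rcases le_total R ℓ with hRℓ | hRℓ
  · refine hlong fun w => ?_
    obtain ⟨s, hs, hsw⟩ := hR z w
    exact ⟨_, h ▸ ⟨s, ⟨hs.1, hs.2.trans hRℓ⟩, rfl⟩, hsw⟩
  · obtain ⟨s, hs, hsz⟩ := hR y z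
    refine hdist (y + pr (s • vs)) ℓ hℓ (stArc_subset_stArc y hs.1 (by linarith [hs.2])) ?_
    rw [h]
    refine hausdorffDist_le_of_mem_dist hε.le ?_ ?_
    · rintro _ ⟨t, ht, rfl⟩
      exact ⟨_, ⟨t, ht, rfl⟩, by rwa [dist_add_right, dist_comm]⟩
    · rintro _ ⟨t, ht, rfl⟩
      exact ⟨_, ⟨t, ht, rfl⟩, by rwa [dist_add_right]⟩

/-- Negative iterates of any nontrivial stable arc converge, in the second order
Hausdorff distance, to the hypercontinuum F̃ˢ = closure of C(Fˢ): that is,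
dist_{H²}(i(f^{-n}(Aˢ)), F̃ˢ) → 0 as n → +∞, where i(f^{-n}(Aˢ)) is the set of
subcontinua of f^{-n}(Aˢ) and the closure is taken in (C(T²), dist_H). -/
theorem stable_arc_negative_iterates_tendsto_stable_hypercontinuum
    (x : T2) (L : ℝ) (hL : 0 < L) :
    Tendsto (fun n : ℕ =>
        hausdorffDist
          ({B : Continua T2 | (B.1 : Set T2) ⊆ fA^[n] ⁻¹' stArc x L} : Set (Continua T2))
          (closure CFs))
      atTop (nhds 0) := by
  rw [Metric.tendsto_nhds]
  intro ε hε
  obtain ⟨R, hR⟩ := exists_length_forall_mem_CFs_exists_dist_le (ε := ε / 4) (by linarith)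
  have hφ : 1 < Real.goldenRatio + 1 := by linarith [Real.goldenRatio_pos]
  filter_upwards [((tendsto_pow_atTop_atTop_of_one_lt hφ).atTop_mul_const hL).eventually_ge_atTop R]
    with n hn
  obtain ⟨y, hy⟩ := exists_preimage_iterate_fA_stArc x L n
  rw [hy, Real.dist_eq, sub_zero, abs_of_nonneg hausdorffDist_nonneg]
  refine (hausdorffDist_le_of_mem_dist (r := ε / 2) (by linarith) ?_ ?_).trans_lt (by linarith)
  · intro B hB
    exact ⟨B, subset_closure ⟨y, hB.trans (image_subset_range _ _)⟩, by
      rw [dist_self]; linarith⟩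
  · intro A hA
    obtain ⟨A', hA', hAA'⟩ := Metric.mem_closure_iff.mp hA (ε / 4) (by linarith)
    obtain ⟨B, hB, hAB⟩ := hR _ hn y A' hA'
    exact ⟨B, hB, by linarith [dist_triangle A A' B]⟩
end

section
/- Let f be a cw-expansive homeomorphism of a compact metric space X, and let f̃ denote the induced homeomorphism of the double hyperspace, f̃(𝒜) = {f(A) : A ∈ 𝒜}. If Aˢ is a stable continuum with more than one point and Aᵘ is an unstable continuum with more than one point, then the α-limit set α_{f̃}(i(Aˢ)) and the ω-limit set ω_{f̃}(i(Aᵘ)), computed in the double hyperspace, are disjoint. -/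
open Metric Set Filter TopologicalSpace

variable {X : Type*} [MetricSpace X]

/-- The image of a set under the n-th power (n : ℤ) of a homeomorphism. -/
def zim (f : X ≃ₜ X) : ℤ → Set X → Set X
  | (Int.ofNat n), A => (⇑f)^[n] '' A
  | (Int.negSucc n), A => (⇑f.symm)^[n+1] '' A

/-- A homeomorphism is cw-expansive if some δ > 0 satisfies: every connected
subset with more than one point has some iterate of diameter greater than δ. -/
def IsCWExpansive (f : X ≃ₜ X) : Prop :=
  ∃ δ > 0, ∀ A : Set X, IsConnected A → A.Nontrivial →
    ∃ n : ℤ, δ < Metric.diam (zim f n A)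

/-- Wˢ_f : the set of stable continua, i.e. those with diam(fⁿ(A)) → 0 as n → +∞. -/
def Ws (f : X ≃ₜ X) : Set (Continua X) :=
  {A | Tendsto (fun n : ℕ => Metric.diam ((⇑f)^[n] '' (A.1 : Set X))) atTop (nhds 0)}

/-- Wᵘ_f : the set of unstable continua, i.e. the stable continua of f⁻¹. -/
def Wu (f : X ≃ₜ X) : Set (Continua X) := Ws f.symm

/-- i(A): the set of subcontinua of A, as a subset of the hyperspace. -/
def iSet (A : Continua X) : Set (Continua X) := {B | (B.1 : Set X) ⊆ (A.1 : Set X)}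

/-- f̃ⁿ(i(A)) = i(fⁿ(A)): the n-th image under the induced map f̃ of the
hypercontinuum i(A), as a subset of the hyperspace. -/
def iImage (f : X ≃ₜ X) (n : ℕ) (A : Continua X) : Set (Continua X) :=
  {B | (B.1 : Set X) ⊆ (⇑f)^[n] '' (A.1 : Set X)}

/-- The ω-limit set, in the double hyperspace of nonempty compact subsets of
(C(X), dist_H), of the point i(A) under the induced homeomorphism f̃: the set of
points 𝒜 such that f̃^{n_k}(i(A)) → 𝒜 for some sequence of integers n_k → +∞. -/
def omegaLimSet (f : X ≃ₜ X) (A : Continua X) :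
    Set (TopologicalSpace.NonemptyCompacts (Continua X)) :=
  {𝒜 | ∃ nk : ℕ → ℕ, Tendsto nk atTop atTop ∧
    Tendsto (fun k : ℕ => hausdorffDist (iImage f (nk k) A) (𝒜 : Set (Continua X)))
      atTop (nhds 0)}

/-- The α-limit set of i(A) under f̃, i.e. the ω-limit set under the inverse. -/
def alphaLimSet (f : X ≃ₜ X) (A : Continua X) :
    Set (TopologicalSpace.NonemptyCompacts (Continua X)) :=
  omegaLimSet f.symm A

/-- Boundary bumping: a compact connected set on which a continuous function takes values below and
above `r` contains a subcontinuum through a prescribed point of the sublevel set of `r` which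
reaches the level `r`. -/
theorem exists_subcontinuum_of_continuous {Y : Type*} [TopologicalSpace Y] [T2Space Y] {K : Set Y}
    (hK : IsCompact K) (hKc : IsPreconnected K) {g : Y → ℝ} (hg : Continuous g) {r : ℝ} {x y : Y}
    (hx : x ∈ K) (hy : y ∈ K) (hgx : g x ≤ r) (hgy : r ≤ g y) :
    ∃ C ⊆ K, IsCompact C ∧ IsConnected C ∧ x ∈ C ∧ (∀ z ∈ C, g z ≤ r) ∧ ∃ z ∈ C, g z = r := by
  let N : Set Y := K ∩ {z | g z ≤ r}
  have hN : IsCompact N := hK.inter_right (isClosed_le hg continuous_const)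
  have : CompactSpace N := isCompact_iff_compactSpace.mp hN
  let p : N := ⟨x, hx, hgx⟩
  refine ⟨(↑) '' connectedComponent p, ?_, ?_, ?_, ⟨p, mem_connectedComponent, rfl⟩, ?_, ?_⟩
  · rintro _ ⟨z, -, rfl⟩
    exact z.2.1
  · exact isClosed_connectedComponent.isCompact.image continuous_subtype_val
  · exact isConnected_connectedComponent.image _ continuous_subtype_val.continuousOn
  · rintro _ ⟨z, -, rfl⟩
    exact z.2.2
  by_contra! hne
  have hS : IsCompact {z : N | g z = r} :=
    (isClosed_eq (hg.comp continuous_subtype_val) continuous_const).isCompact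
  obtain ⟨Z, hZS⟩ : ∃ Z : { s : Set N // IsClopen s ∧ p ∈ s }, {z : N | g z = r} ∩ Z = ∅ := by
    have : Nonempty { s : Set N // IsClopen s ∧ p ∈ s } := ⟨⟨univ, isClopen_univ, mem_univ _⟩⟩
    refine hS.elim_directed_family_closed
      (fun Z : { s : Set N // IsClopen s ∧ p ∈ s } => (Z : Set N)) (fun Z => Z.2.1.isClosed) ?_ ?_
    · rw [← connectedComponent_eq_iInter_isClopen, eq_empty_iff_forall_notMem]
      rintro z ⟨hz, hzC⟩
      exact hne z ⟨z, hzC, rfl⟩ hz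
    · intro Z W
      exact ⟨⟨Z.1 ∩ W.1, Z.2.1.inter W.2.1, Z.2.2, W.2.2⟩, inter_subset_left, inter_subset_right⟩
  have hZ1 : IsClosed ((↑) '' (Z : Set N) : Set Y) :=
    (Z.2.1.isClosed.isCompact.image continuous_subtype_val).isClosed
  have hZ2 : IsClosed ((↑) '' (Z : Set N)ᶜ : Set Y) :=
    (Z.2.1.compl.isClosed.isCompact.image continuous_subtype_val).isClosed
  have hZlt : ∀ z ∈ (Z : Set N), g z < r := fun z hz =>
    lt_of_le_of_ne z.2.2 fun h => (eq_empty_iff_forall_notMem.mp hZS z) ⟨h, hz⟩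
  obtain ⟨w, -, ⟨a, ha, rfl⟩, hw⟩ := isPreconnected_closed_iff.mp hKc ((↑) '' (Z : Set N))
    ((↑) '' (Z : Set N)ᶜ ∪ {z | r ≤ g z}) hZ1 (hZ2.union (isClosed_le continuous_const hg))
    (fun z hz => by
      by_cases hzr : g z ≤ r
      · by_cases hzZ : (⟨z, hz, hzr⟩ : N) ∈ (Z : Set N)
        · exact Or.inl ⟨_, hzZ, rfl⟩
        · exact Or.inr (Or.inl ⟨_, hzZ, rfl⟩)
      · exact Or.inr (Or.inr (not_le.mp hzr).le))
    ⟨x, hx, p, Z.2.2, rfl⟩ ⟨y, hy, Or.inr hgy⟩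
  rcases hw with ⟨b, hb, hab⟩ | hw
  · exact hb (Subtype.ext hab ▸ ha)
  · exact absurd (hZlt a ha) (not_lt.mpr hw)

namespace TopologicalSpace.NonemptyCompacts

theorem diam_le_add_dist (K L : NonemptyCompacts X) :
    diam (K : Set X) ≤ diam (L : Set X) + 2 * dist K L := by
  refine le_of_forall_pos_lt_add fun ε hε => ?_
  have hKL : hausdorffDist (K : Set X) L < dist K L + ε / 3 := by
    rw [← NonemptyCompacts.dist_eq]
    linarith
  have hfin : hausdorffEDist (K : Set X) L ≠ ⊤ :=
    hausdorffEDist_ne_top_of_nonempty_of_bounded K.nonempty L.nonempty K.isCompact.isBounded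
      L.isCompact.isBounded
  have : diam (K : Set X) ≤ diam (L : Set X) + 2 * (dist K L + ε / 3) := by
    refine diam_le_of_forall_dist_le (by positivity) fun x hx y hy => ?_
    obtain ⟨x', hx', hxx⟩ := exists_dist_lt_of_hausdorffDist_lt hx hKL hfin
    obtain ⟨y', hy', hyy⟩ := exists_dist_lt_of_hausdorffDist_lt hy hKL hfin
    have h1 := dist_triangle4 x x' y' y
    have h2 := dist_le_diam_of_mem L.isCompact.isBounded hx' hy'
    rw [dist_comm y' y] at h1
    linarith
  linarith

theorem continuous_diam : Continuous fun K : NonemptyCompacts X => diam (K : Set X) :=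
  (LipschitzWith.of_le_add_mul 2 fun K L => diam_le_add_dist K L).continuous

theorem isClosed_setOf_isConnected :
    IsClosed {K : NonemptyCompacts X | IsConnected (K : Set X)} := by
  rw [← isOpen_compl_iff, isOpen_iff_mem_nhds]
  intro K hK
  have hK' : ¬ IsPreconnected (K : Set X) := fun h => hK ⟨K.nonempty, h⟩
  rw [isPreconnected_iff_subset_of_fully_disjoint_closed K.isCompact.isClosed] at hK'
  push Not at hK'
  obtain ⟨F, G, hF, hG, hsub, hdisj, hKF, hKG⟩ := hK'
  obtain ⟨U, V, hU, hV, hFU, hGV, hUV⟩ := normal_separation hF hG hdisj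
  obtain ⟨a, ha, haF⟩ := not_subset.mp hKF
  obtain ⟨b, hb, hbG⟩ := not_subset.mp hKG
  have hO : IsOpen ({L : NonemptyCompacts X | (L : Set X) ⊆ U ∪ V} ∩
      {L | ((L : Set X) ∩ U).Nonempty} ∩ {L | ((L : Set X) ∩ V).Nonempty}) :=
    ((isOpen_subsets_of_isOpen (hU.union hV)).inter (isOpen_inter_nonempty_of_isOpen hU)).inter
      (isOpen_inter_nonempty_of_isOpen hV)
  refine Filter.mem_of_superset (hO.mem_nhds ⟨⟨?_, ?_⟩, ?_⟩) ?_
  · exact hsub.trans (union_subset_union hFU hGV)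
  · exact ⟨b, hb, hFU ((hsub hb).resolve_right hbG)⟩
  · exact ⟨a, ha, hGV ((hsub ha).resolve_left haF)⟩
  · rintro L ⟨⟨hL, hLU⟩, hLV⟩ hLc
    obtain ⟨z, -, hzU, hzV⟩ := hLc.isPreconnected U V hU hV hL hLU hLV
    exact disjoint_left.mp hUV hzU hzV

end TopologicalSpace.NonemptyCompacts

instance [CompactSpace X] : CompactSpace (Continua X) :=
  isCompact_iff_compactSpace.mp NonemptyCompacts.isClosed_setOf_isConnected.isCompact

namespace Continua

theorem continuous_diam_image (h : X ≃ₜ X) :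
    Continuous fun K : Continua X => diam (h '' (K.1 : Set X)) :=
  NonemptyCompacts.continuous_diam.comp
    ((h.continuous.nonemptyCompacts_map).comp continuous_subtype_val)

/-- The continuum obtained as the image of a continuum under a homeomorphism. -/
def image (h : X ≃ₜ X) (K : Continua X) : Continua X :=
  ⟨K.1.map h h.continuous, K.2.image h h.continuous.continuousOn⟩

@[simp]
theorem coe_image (h : X ≃ₜ X) (K : Continua X) :
    ((image h K).1 : Set X) = h '' (K.1 : Set X) := rfl

theorem isBounded_image (h : X ≃ₜ X) (K : Continua X) :
    Bornology.IsBounded (h '' (K.1 : Set X)) := (image h K).1.isCompact.isBounded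

theorem isBounded_coe (K : Continua X) : Bornology.IsBounded (K.1 : Set X) :=
  K.1.isCompact.isBounded

theorem nontrivial_of_diam_pos {K : Continua X} (h : 0 < diam (K.1 : Set X)) :
    (K.1 : Set X).Nontrivial :=
  not_subsingleton_iff.mp fun hs => h.ne' (diam_subsingleton hs)

end Continua

theorem Homeomorph.image_zpow_image_zpow (f : X ≃ₜ X) (m n : ℤ) (A : Set X) :
    ⇑(f ^ m) '' (⇑(f ^ n) '' A) = ⇑(f ^ (m + n)) '' A := by
  rw [zpow_add, image_image]
  rfl

theorem Homeomorph.coe_zpow_natCast (f : X ≃ₜ X) (n : ℕ) : ⇑(f ^ (n : ℤ)) = (⇑f)^[n] := by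
  rw [zpow_natCast]
  induction n with
  | zero => rfl
  | succ n ih => rw [pow_succ, Function.iterate_succ, ← ih]; rfl

theorem Homeomorph.coe_zpow_neg_natCast (f : X ≃ₜ X) (n : ℕ) :
    ⇑(f ^ (-(n : ℤ))) = (⇑f.symm)^[n] := by
  rw [← coe_zpow_natCast, zpow_neg, ← inv_zpow]
  rfl

theorem zim_eq_image_zpow (f : X ≃ₜ X) (n : ℤ) (A : Set X) : zim f n A = ⇑(f ^ n) '' A := by
  cases n with
  | ofNat n => exact congrArg (· '' A) (f.coe_zpow_natCast n).symm
  | negSucc n => exact congrArg (· '' A) (f.coe_zpow_neg_natCast (n + 1)).symm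

/-- `δ` is a cw-expansivity constant of `f` on continua. -/
def IsCWConstant (f : X ≃ₜ X) (δ : ℝ) : Prop :=
  ∀ K : Continua X, (K.1 : Set X).Nontrivial → ∃ n : ℤ, δ < diam (⇑(f ^ n) '' (K.1 : Set X))

theorem IsCWConstant.inv {f : X ≃ₜ X} {δ : ℝ} (h : IsCWConstant f δ) : IsCWConstant f⁻¹ δ := by
  intro K hK
  obtain ⟨n, hn⟩ := h K hK
  exact ⟨-n, by rwa [inv_zpow, zpow_neg, inv_inv]⟩

theorem IsCWConstant.exists_diam_lt [CompactSpace X] {f : X ≃ₜ X} {δ : ℝ} (h : IsCWConstant f δ)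
    {r : ℝ} (hr : 0 < r) :
    ∃ N : ℕ, ∀ B : Continua X,
      (∀ j : ℤ, |j| ≤ N → diam (⇑(f ^ j) '' (B.1 : Set X)) ≤ δ) → diam (B.1 : Set X) < r := by
  by_contra! hcon
  let S : ℕ → Set (Continua X) := fun N =>
    {B | ∀ j : ℤ, |j| ≤ N → diam (⇑(f ^ j) '' (B.1 : Set X)) ≤ δ} ∩ {B | r ≤ diam (B.1 : Set X)}
  have hS : ∀ N, IsClosed (S N) := by
    intro N
    refine IsClosed.inter ?_ (isClosed_le continuous_const
      (NonemptyCompacts.continuous_diam.comp continuous_subtype_val))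
    simp only [ofPred_forall]
    exact isClosed_iInter fun j => isClosed_iInter fun _ =>
      isClosed_le (Continua.continuous_diam_image _) continuous_const
  obtain ⟨B, hB⟩ := IsCompact.nonempty_iInter_of_sequence_nonempty_isCompact_isClosed S
    (fun N B hB => ⟨fun j hj => hB.1 j (hj.trans (by push_cast; linarith)), hB.2⟩)
    (fun N => (hcon N).imp fun B hB => hB) (hS 0).isCompact hS
  rw [mem_iInter] at hB
  obtain ⟨n, hn⟩ := h B (Continua.nontrivial_of_diam_pos (hr.trans_le (hB 0).2))
  exact absurd ((hB n.natAbs).1 n (by simp)) (not_le.mpr hn)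

theorem exists_forall_diam_image_zpow_le [CompactSpace X] (f : X ≃ₜ X) (N : ℕ) {r : ℝ}
    (hr : 0 < r) :
    ∃ η > 0, ∀ C : Continua X, diam (C.1 : Set X) ≤ η →
      ∀ i : ℤ, |i| ≤ N → diam (⇑(f ^ i) '' (C.1 : Set X)) ≤ r := by
  have hev : ∀ᶠ p : X × X in uniformity X,
      ∀ i ∈ Finset.Icc (-(N : ℤ)) N, dist ((f ^ i : X ≃ₜ X) p.1) ((f ^ i : X ≃ₜ X) p.2) < r := by
    rw [Filter.eventually_all_finset]
    intro i _
    exact (CompactSpace.uniformContinuous_of_continuous (f ^ i).continuous)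
      (Metric.dist_mem_uniformity hr)
  obtain ⟨ε, hε, hεr⟩ := Metric.mem_uniformity_dist.mp hev
  refine ⟨ε / 2, by positivity, fun C hC i hi => ?_⟩
  refine diam_le_of_forall_dist_le hr.le ?_
  rintro _ ⟨x, hx, rfl⟩ _ ⟨y, hy, rfl⟩
  refine (hεr (a := x) (b := y) ?_ i (Finset.mem_Icc.mpr (abs_le.mp hi))).le
  linarith [dist_le_diam_of_mem C.isBounded_coe hx hy]

/-- A continuum which is small at two times is not large at any time in between. -/
theorem IsCWConstant.exists_forall_diam_le [CompactSpace X] {f : X ≃ₜ X} {δ : ℝ} (hδ : 0 < δ)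
    (h : IsCWConstant f δ) :
    ∃ η > 0, ∀ (C : Continua X) (n : ℕ), diam (C.1 : Set X) ≤ η →
      diam (⇑(f ^ (n : ℤ)) '' (C.1 : Set X)) ≤ η →
      ∀ j : ℕ, j ≤ n → diam (⇑(f ^ (j : ℤ)) '' (C.1 : Set X)) ≤ δ := by
  obtain ⟨N, hN⟩ := h.exists_diam_lt (half_pos hδ)
  obtain ⟨η, hη, hηN⟩ := exists_forall_diam_image_zpow_le f N (r := δ / 4) (by positivity)
  refine ⟨η, hη, fun C n hC0 hCn j₀ hj₀ => ?_⟩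
  by_contra! hlt
  obtain ⟨x, hx, y, hy, hxy⟩ : ∃ x ∈ (C.1 : Set X), ∃ y ∈ (C.1 : Set X),
      δ < dist ((f ^ (j₀ : ℤ) : X ≃ₜ X) x) ((f ^ (j₀ : ℤ) : X ≃ₜ X) y) := by
    by_contra! hle
    refine absurd (diam_le_of_forall_dist_le hδ.le ?_) (not_le.mpr hlt)
    rintro _ ⟨x, hx, rfl⟩ _ ⟨y, hy, rfl⟩
    exact hle x hx y hy
  have hne : (Finset.range (n + 1)).Nonempty := Finset.nonempty_range_add_one
  let d : ℕ → X → ℝ := fun j z => dist ((f ^ (j : ℤ) : X ≃ₜ X) x) ((f ^ (j : ℤ) : X ≃ₜ X) z)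
  let g : X → ℝ := fun z => (Finset.range (n + 1)).sup' hne fun j => d j z
  have hg : Continuous g := Continuous.finset_sup'_apply hne fun j _ =>
    continuous_const.dist (f ^ (j : ℤ)).continuous
  have hdg : ∀ z, ∀ j ≤ n, d j z ≤ g z := fun z j hj =>
    Finset.le_sup' (fun j => d j z) (Finset.mem_range_succ_iff.mpr hj)
  have hgx : g x ≤ δ / 2 := Finset.sup'_le _ _ fun j _ => by simp only [d, dist_self]; positivity
  have hgy : δ / 2 ≤ g y := le_trans (by simp only [d]; linarith) (hdg y j₀ hj₀)
  obtain ⟨B', hBC, hBcomp, hBconn, hxB, hBle, z, hzB, hz⟩ :=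
    exists_subcontinuum_of_continuous C.1.isCompact C.2.isPreconnected hg hx hy hgx hgy
  let B : Continua X := ⟨⟨⟨B', hBcomp⟩, hBconn.nonempty⟩, hBconn⟩
  have hBδ : ∀ j ≤ n, diam (⇑(f ^ (j : ℤ)) '' B') ≤ δ := by
    intro j hj
    refine diam_le_of_forall_dist_le hδ.le ?_
    rintro _ ⟨u, hu, rfl⟩ _ ⟨v, hv, rfl⟩
    have hu' := (hdg u j hj).trans (hBle u hu)
    have hv' := (hdg v j hj).trans (hBle v hv)
    refine (dist_triangle_left _ _ ((f ^ (j : ℤ) : X ≃ₜ X) x)).trans ?_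
    simp only [d] at hu' hv'
    linarith
  obtain ⟨j, hj, hjz⟩ := Finset.exists_mem_eq_sup' hne fun j => d j z
  have hjn := Finset.mem_range_succ_iff.mp hj
  have hlow : δ / 2 ≤ diam (⇑(f ^ (j : ℤ)) '' B') := by
    rw [← hz]
    exact hjz.le.trans (dist_le_diam_of_mem (B.isBounded_image _) (mem_image_of_mem _ hxB)
      (mem_image_of_mem _ hzB))
  have hmono : diam (⇑(f ^ (j : ℤ)) '' B') ≤ diam (⇑(f ^ (j : ℤ)) '' (C.1 : Set X)) :=
    diam_mono (image_mono hBC) (C.isBounded_image _)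
  by_cases hjN : j ≤ N
  · have := hηN C hC0 j (by rw [Nat.abs_cast]; exact_mod_cast hjN)
    linarith
  by_cases hnjN : n - j ≤ N
  · have := hηN (C.image (f ^ (n : ℤ))) hCn (j - n) (by rw [abs_le]; omega)
    rw [Continua.coe_image, f.image_zpow_image_zpow, sub_add_cancel] at this
    linarith
  refine absurd (hN (B.image (f ^ (j : ℤ))) fun i hi => ?_) (not_lt.mpr hlow)
  rw [Continua.coe_image, f.image_zpow_image_zpow]
  rw [abs_le] at hi
  have := hBδ (i + j).toNat (by omega)
  rwa [Int.toNat_of_nonneg (by omega)] at this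

section OmegaLimit

variable {f : X ≃ₜ X} {A : Continua X} {δ η : ℝ} {𝒜 : NonemptyCompacts (Continua X)}

theorem mem_iImage_image_zpow (f : X ≃ₜ X) (n : ℕ) (A : Continua X) :
    A.image (f ^ (n : ℤ)) ∈ iImage f n A := by
  change ⇑(f ^ (n : ℤ)) '' (A.1 : Set X) ⊆ (⇑f)^[n] '' (A.1 : Set X)
  rw [f.coe_zpow_natCast]

theorem diam_image_zpow_neg_le_of_mem_iImage
    (hη : ∀ (C : Continua X) (n : ℕ), diam (C.1 : Set X) ≤ η →
      diam (⇑(f⁻¹ ^ (n : ℤ)) '' (C.1 : Set X)) ≤ η →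
      ∀ j : ℕ, j ≤ n → diam (⇑(f⁻¹ ^ (j : ℤ)) '' (C.1 : Set X)) ≤ δ)
    {M : ℕ} (hM : diam (⇑(f⁻¹ ^ (M : ℤ)) '' (A.1 : Set X)) ≤ η) {m : ℕ} {D : Continua X}
    (hD : D ∈ iImage f m A) (hDη : diam (D.1 : Set X) ≤ η) {j : ℕ} (hj : j ≤ m + M) :
    diam (⇑(f⁻¹ ^ (j : ℤ)) '' (D.1 : Set X)) ≤ δ := by
  refine hη D (m + M) hDη (le_trans ?_ hM) j hj
  refine diam_mono ?_ (A.isBounded_image _)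
  refine (image_mono hD).trans ?_
  rw [← f.coe_zpow_natCast, inv_zpow', inv_zpow', f.image_zpow_image_zpow]
  push_cast
  rw [neg_add_rev, neg_add_cancel_right]

variable [CompactSpace X]

theorem hausdorffEDist_iImage_ne_top (f : X ≃ₜ X) (n : ℕ) (A : Continua X)
    (𝒜 : NonemptyCompacts (Continua X)) :
    hausdorffEDist (iImage f n A) (𝒜 : Set (Continua X)) ≠ ⊤ :=
  hausdorffEDist_ne_top_of_nonempty_of_bounded ⟨_, mem_iImage_image_zpow f n A⟩ 𝒜.nonempty
    (Bornology.IsBounded.all _) 𝒜.isCompact.isBounded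

theorem diam_image_zpow_neg_le_of_mem_omegaLimSet
    (hη : ∀ (C : Continua X) (n : ℕ), diam (C.1 : Set X) ≤ η →
      diam (⇑(f⁻¹ ^ (n : ℤ)) '' (C.1 : Set X)) ≤ η →
      ∀ j : ℕ, j ≤ n → diam (⇑(f⁻¹ ^ (j : ℤ)) '' (C.1 : Set X)) ≤ δ)
    {M : ℕ} (hM : diam (⇑(f⁻¹ ^ (M : ℤ)) '' (A.1 : Set X)) ≤ η)
    (h𝒜 : 𝒜 ∈ omegaLimSet f A) {C : Continua X} (hC : C ∈ 𝒜) (hCη : diam (C.1 : Set X) < η)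
    (n : ℕ) : diam (⇑(f⁻¹ ^ (n : ℤ)) '' (C.1 : Set X)) ≤ δ := by
  obtain ⟨nk, hnk, hlim⟩ := h𝒜
  have hclosed : IsClosed {D : Continua X | diam (⇑(f⁻¹ ^ (n : ℤ)) '' (D.1 : Set X)) ≤ δ} :=
    isClosed_le (Continua.continuous_diam_image _) continuous_const
  refine hclosed.closure_subset (Metric.mem_closure_iff.mpr fun ε hε => ?_)
  obtain ⟨k, hkn, hk⟩ := ((hnk.eventually_ge_atTop n).and (hlim.eventually_lt_const
    (lt_min hε (half_pos (sub_pos.mpr hCη))))).exists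
  obtain ⟨D, hD, hDC⟩ := exists_dist_lt_of_hausdorffDist_lt' hC hk
    (hausdorffEDist_iImage_ne_top f (nk k) A 𝒜)
  have hDC' : dist D.1 C.1 < _ := hDC
  have hdiam := NonemptyCompacts.diam_le_add_dist D.1 C.1
  refine ⟨D, diam_image_zpow_neg_le_of_mem_iImage hη hM hD ?_ (hkn.trans (Nat.le_add_right _ _)),
    ?_⟩
  · linarith [hDC'.trans_le (min_le_right _ _)]
  · rw [dist_comm]
    exact hDC.trans_le (min_le_left _ _)

theorem exists_mem_omegaLimSet_diam_pos (h : IsCWConstant f δ) (hηpos : 0 < η) (hδ : 0 < δ)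
    (hη : ∀ (C : Continua X) (n : ℕ), diam (C.1 : Set X) ≤ η →
      diam (⇑(f⁻¹ ^ (n : ℤ)) '' (C.1 : Set X)) ≤ η →
      ∀ j : ℕ, j ≤ n → diam (⇑(f⁻¹ ^ (j : ℤ)) '' (C.1 : Set X)) ≤ δ)
    (hA : Tendsto (fun n : ℕ => diam (⇑(f⁻¹ ^ (n : ℤ)) '' (A.1 : Set X))) atTop (nhds 0))
    (hAnt : (A.1 : Set X).Nontrivial) (h𝒜 : 𝒜 ∈ omegaLimSet f A) :
    ∃ C ∈ 𝒜, 0 < diam (C.1 : Set X) ∧ diam (C.1 : Set X) < η := by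
  obtain ⟨nk, hnk, hlim⟩ := h𝒜
  obtain ⟨M, hM⟩ := eventually_atTop.mp (hA.eventually_lt_const (lt_min hηpos hδ))
  have hlarge : ∃ᶠ k in atTop, η < diam (⇑(f ^ (nk k : ℤ)) '' (A.1 : Set X)) := by
    intro hcon
    obtain ⟨i, hi⟩ := h A hAnt
    refine absurd hi (not_lt.mpr ?_)
    by_cases hiM : i ≤ -M
    · have := (hM (-i).toNat (by omega)).le.trans (min_le_right _ _)
      rwa [Int.toNat_of_nonneg (by omega), inv_zpow', neg_neg] at this
    obtain ⟨k, hk, hki⟩ := (hcon.and (hnk.eventually_ge_atTop i.toNat)).exists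
    have := diam_image_zpow_neg_le_of_mem_iImage hη ((hM M le_rfl).le.trans (min_le_left _ _))
      (mem_iImage_image_zpow f (nk k) A) (not_lt.mp hk) (j := (nk k - i).toNat) (by omega)
    rwa [Int.toNat_of_nonneg (by omega), Continua.coe_image, inv_zpow', f.image_zpow_image_zpow,
      neg_sub, sub_add_cancel] at this
  obtain ⟨k, hk, hkd⟩ := (hlarge.and_eventually
    (hlim.eventually_lt_const (show 0 < η / 16 by positivity))).exists
  let E : Continua X := A.image (f ^ (nk k : ℤ))
  obtain ⟨x, hx, y, hy, hxy⟩ : ∃ x ∈ (E.1 : Set X), ∃ y ∈ (E.1 : Set X), η < dist x y := by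
    by_contra! hle
    exact absurd (diam_le_of_forall_dist_le hηpos.le hle) (not_le.mpr hk)
  obtain ⟨B', hBE, hBcomp, hBconn, hxB, hBle, z, hzB, hz⟩ :=
    exists_subcontinuum_of_continuous E.1.isCompact E.2.isPreconnected
      (continuous_const.dist continuous_id : Continuous fun z => dist x z) (r := η / 4) hx hy
      (by rw [dist_self]; positivity) (by linarith)
  let B : Continua X := ⟨⟨⟨B', hBcomp⟩, hBconn.nonempty⟩, hBconn⟩
  have hBmem : B ∈ iImage f (nk k) A := hBE.trans (mem_iImage_image_zpow f (nk k) A)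
  have hBup : diam (B.1 : Set X) ≤ η / 2 := by
    refine diam_le_of_forall_dist_le (by positivity) fun u hu v hv => ?_
    linarith [dist_triangle_left u v x, hBle u hu, hBle v hv]
  have hBlow : η / 4 ≤ diam (B.1 : Set X) := by
    rw [← hz]
    exact dist_le_diam_of_mem B.isBounded_coe hxB hzB
  obtain ⟨C, hC, hBC⟩ := exists_dist_lt_of_hausdorffDist_lt hBmem hkd
    (hausdorffEDist_iImage_ne_top f (nk k) A 𝒜)
  have hBC' : dist B.1 C.1 < η / 16 := hBC
  have h1 := NonemptyCompacts.diam_le_add_dist B.1 C.1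
  have h2 := NonemptyCompacts.diam_le_add_dist C.1 B.1
  rw [dist_comm C.1 B.1] at h2
  exact ⟨C, hC, by linarith, by linarith⟩

end OmegaLimit

/-- If f is a cw-expansive homeomorphism of a compact metric space, Aˢ is a stable
continuum with more than one point and Aᵘ is an unstable continuum with more than one
point, then α_{f̃}(i(Aˢ)) and ω_{f̃}(i(Aᵘ)), computed in the double hyperspace,
are disjoint. -/
theorem alphaLimSet_disjoint_omegaLimSet
    [CompactSpace X] (f : X ≃ₜ X) (hcw : IsCWExpansive f)
    (As Au : Continua X) (hAs : As ∈ Ws f) (hAsnt : (As.1 : Set X).Nontrivial)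
    (hAu : Au ∈ Wu f) (hAunt : (Au.1 : Set X).Nontrivial) :
    Disjoint (alphaLimSet f As) (omegaLimSet f Au) := by
  obtain ⟨δ, hδ, hexp⟩ := hcw
  have hf : IsCWConstant f δ := fun K hK => by
    simpa only [zim_eq_image_zpow] using hexp (K.1 : Set X) K.2 hK
  obtain ⟨η₁, hη₁, h₁⟩ := hf.exists_forall_diam_le hδ
  obtain ⟨η₂, hη₂, h₂⟩ := hf.inv.exists_forall_diam_le hδ
  have hAs' : Tendsto (fun n : ℕ => diam (⇑(f⁻¹⁻¹ ^ (n : ℤ)) '' (As.1 : Set X))) atTop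
      (nhds 0) := by
    simp_rw [inv_inv, Homeomorph.coe_zpow_natCast]
    exact hAs
  have hAu' : Tendsto (fun n : ℕ => diam (⇑(f⁻¹ ^ (n : ℤ)) '' (Au.1 : Set X))) atTop
      (nhds 0) := by
    simp_rw [Homeomorph.coe_zpow_natCast]
    exact hAu
  obtain ⟨M₁, hM₁⟩ := (hAs'.eventually_lt_const hη₁).exists
  obtain ⟨M₂, hM₂⟩ := (hAu'.eventually_lt_const hη₂).exists
  rw [disjoint_left]
  intro 𝒜 hα hω
  obtain ⟨C, hC, hCpos, hClt⟩ := exists_mem_omegaLimSet_diam_pos hf (lt_min hη₁ hη₂) hδ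
    (fun C n hC hCn => h₂ C n (hC.trans (min_le_right _ _)) (hCn.trans (min_le_right _ _)))
    hAu' hAunt hω
  obtain ⟨n, hn⟩ := hf C (Continua.nontrivial_of_diam_pos hCpos)
  refine absurd hn (not_lt.mpr ?_)
  obtain ⟨m, rfl | rfl⟩ := n.eq_nat_or_neg
  · rw [← inv_inv f]
    exact diam_image_zpow_neg_le_of_mem_omegaLimSet (f := f⁻¹) (by rwa [inv_inv]) hM₁.le hα hC
      (hClt.trans_le (min_le_left _ _)) m
  · rw [← inv_zpow']
    exact diam_image_zpow_neg_le_of_mem_omegaLimSet h₂ hM₂.le hω hC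
      (hClt.trans_le (min_le_right _ _)) m
end

section
/- If f is a cw-expansive homeomorphism of a continuum X (a compact connected metric space) satisfying condition (PA), then f is topologically mixing: for any nonempty open sets U, V ⊆ X there is N > 0 such that U ∩ f^n(V) ≠ ∅ for all n ≥ N. -/
open Metric Set Filter TopologicalSpace

variable {X : Type*} [MetricSpace X]

/-- Condition (PA): for every nontrivial stable continuum Aˢ,
dist_{H²}(i(f^{-n}(Aˢ)), F̃ˢ) → 0, and for every nontrivial unstable continuum Aᵘ,
dist_{H²}(i(fⁿ(Aᵘ)), F̃ᵘ) → 0, where F̃ˢ, F̃ᵘ are the closures of Wˢ_f, Wᵘ_f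
in the hyperspace. -/
def CondPA (f : X ≃ₜ X) : Prop :=
  (∀ A : Continua X, A ∈ Ws f → (A.1 : Set X).Nontrivial →
    Tendsto (fun n : ℕ =>
      hausdorffDist {B : Continua X | (B.1 : Set X) ⊆ (⇑f.symm)^[n] '' (A.1 : Set X)}
        (closure (Ws f))) atTop (nhds 0)) ∧
  (∀ A : Continua X, A ∈ Wu f → (A.1 : Set X).Nontrivial →
    Tendsto (fun n : ℕ =>
      hausdorffDist {B : Continua X | (B.1 : Set X) ⊆ (⇑f)^[n] '' (A.1 : Set X)}
        (closure (Wu f))) atTop (nhds 0))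

namespace CWExpansive

section Hyperspace

/-- A weak form of the boundary bumping theorem: a nondegenerate continuum meeting an open set
contains a nondegenerate continuum inside that open set. -/
theorem exists_nontrivial_subcontinuum_subset {K V : Set X} (hK : IsCompact K)
    (hKc : IsConnected K) (hKn : K.Nontrivial) (hV : IsOpen V) (hKV : (K ∩ V).Nonempty) :
    ∃ C, C ⊆ K ∩ V ∧ IsCompact C ∧ IsConnected C ∧ C.Nontrivial := by
  obtain ⟨x, hxK, hxV⟩ := hKV
  obtain ⟨y, hyK, hyx⟩ := hKn.exists_ne x
  obtain ⟨r, hr, hrV⟩ := Metric.isOpen_iff.1 hV x hxV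
  set s := min (r / 2) (dist y x / 2)
  have hd : 0 < dist y x := dist_pos.2 hyx
  have hs0 : 0 < s := lt_min (by linarith) (by linarith)
  set F := K ∩ closedBall x s
  have hFcl : IsCompact F := hK.inter_right isClosed_closedBall
  have hxF : x ∈ F := ⟨hxK, mem_closedBall_self hs0.le⟩
  have hFV : F ⊆ K ∩ V := fun z hz => ⟨hz.1, hrV (lt_of_le_of_lt hz.2
    (lt_of_le_of_lt (min_le_left _ _) (half_lt_self hr)))⟩
  have hyF : y ∉ F := fun h => by
    have h1 : dist y x ≤ s := h.2
    have h2 : s ≤ dist y x / 2 := min_le_right _ _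
    linarith
  have : CompactSpace F := isCompact_iff_compactSpace.1 hFcl
  let x' : F := ⟨x, hxF⟩
  refine ⟨(↑) '' connectedComponent x', ?_, ?_, ?_, ?_⟩
  · rintro _ ⟨z, -, rfl⟩
    exact hFV z.2
  · exact isClosed_connectedComponent.isCompact.image continuous_subtype_val
  · exact isConnected_connectedComponent.image _ continuous_subtype_val.continuousOn
  · rw [← Set.not_subsingleton_iff]
    intro hsub
    have hsub' : connectedComponent x' = {x'} := by
      refine subset_antisymm (fun z hz => ?_) (singleton_subset_iff.2 mem_connectedComponent)
      exact Subtype.ext (hsub ⟨z, hz, rfl⟩ ⟨x', mem_connectedComponent, rfl⟩)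
    rw [connectedComponent_eq_iInter_isClopen] at hsub'
    have hball : IsOpen ((↑) ⁻¹' ball x s : Set F) := isOpen_ball.preimage continuous_subtype_val
    have : Nonempty {D : Set F // IsClopen D ∧ x' ∈ D} := ⟨⟨univ, isClopen_univ, mem_univ _⟩⟩
    obtain ⟨⟨D, hD, hxD⟩, hDs⟩ := exists_subset_nhds_of_compactSpace
      (V := fun D : {D : Set F // IsClopen D ∧ x' ∈ D} => D.1)
      (fun A B => ⟨⟨A.1 ∩ B.1, A.2.1.inter B.2.1, A.2.2, B.2.2⟩,
        inter_subset_left, inter_subset_right⟩)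
      (fun D => D.2.1.1) (U := (↑) ⁻¹' ball x s) (by
        intro z hz
        rw [hsub'] at hz
        rw [hz]
        exact hball.mem_nhds (mem_ball_self hs0))
    obtain ⟨O, hO, hOD⟩ := isOpen_induced_iff.1 hD.2
    have hDcl : IsClosed ((↑) '' D : Set X) :=
      (hD.1.isCompact.image continuous_subtype_val).isClosed
    obtain ⟨z, hzK, hz1, hz2⟩ := hKc.2 (O ∩ ball x s) ((↑) '' D : Set X)ᶜ (hO.inter isOpen_ball)
      hDcl.isOpen_compl (by
        intro z hz
        by_cases h : z ∈ ((↑) '' D : Set X)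
        · obtain ⟨w, hw, rfl⟩ := h
          left
          exact ⟨by rw [← hOD] at hw; exact hw, hDs hw⟩
        · exact Or.inr h)
      ⟨x, hxK, by rw [← hOD] at hxD; exact hxD, mem_ball_self hs0⟩
      ⟨y, hyK, by rintro ⟨w, -, hw⟩; exact hyF (hw ▸ w.2)⟩
    refine hz2 ⟨⟨z, hzK, ball_subset_closedBall hz1.2⟩, ?_, rfl⟩
    rw [← hOD]
    exact hz1.1

theorem isClosed_setOf_isConnected :
    IsClosed {K : NonemptyCompacts X | IsConnected (K : Set X)} := by
  rw [← isOpen_compl_iff, isOpen_iff_mem_nhds]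
  intro K hK
  have hK' : ¬ IsPreconnected (K : Set X) := fun h => hK ⟨K.nonempty, h⟩
  rw [isPreconnected_iff_subset_of_fully_disjoint_closed K.isCompact.isClosed] at hK'
  push Not at hK'
  obtain ⟨u, v, hu, hv, hKuv, huv, hKu, hKv⟩ := hK'
  obtain ⟨U, V, hU, hV, huU, hvV, hUV⟩ := normal_separation hu hv huv
  have key : ∀ a b : Set X, (K : Set X) ⊆ a ∪ b → ¬ (K : Set X) ⊆ a → ((K : Set X) ∩ b).Nonempty := by
    intro a b hab ha
    obtain ⟨z, hz, hza⟩ := not_subset.1 ha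
    exact ⟨z, hz, (hab hz).resolve_left hza⟩
  have h1 := (NonemptyCompacts.isOpen_subsets_of_isOpen (hU.union hV)).mem_nhds
    (show K ∈ _ from hKuv.trans (union_subset_union huU hvV))
  have h2 := (NonemptyCompacts.isOpen_inter_nonempty_of_isOpen hV).mem_nhds
    (show K ∈ _ from (key u v hKuv hKu).mono (inter_subset_inter_right _ hvV))
  have h3 := (NonemptyCompacts.isOpen_inter_nonempty_of_isOpen hU).mem_nhds
    (show K ∈ _ from (key v u (by rwa [union_comm]) hKv).mono (inter_subset_inter_right _ huU))
  filter_upwards [h1, h2, h3] with L hL1 hL2 hL3 hL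
  obtain ⟨z, -, hz⟩ := hL.2 U V hU hV hL1 hL3 hL2
  exact hUV.le_bot hz

instance [CompactSpace X] : CompactSpace (Continua X) :=
  isCompact_iff_compactSpace.1 isClosed_setOf_isConnected.isCompact

theorem diam_le_diam_add (K L : NonemptyCompacts X) :
    diam (K : Set X) ≤ diam (L : Set X) + 2 * dist K L := by
  refine le_of_forall_pos_le_add fun ε hε => ?_
  refine diam_le_of_forall_dist_le (by positivity) fun x hx y hy => ?_
  have hlt : hausdorffDist (K : Set X) L < dist K L + ε / 2 := by
    rw [NonemptyCompacts.dist_eq]; linarith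
  have fin := hausdorffEDist_ne_top_of_nonempty_of_bounded K.nonempty L.nonempty
    K.isCompact.isBounded L.isCompact.isBounded
  obtain ⟨x', hx', hxx'⟩ := exists_dist_lt_of_hausdorffDist_lt hx hlt fin
  obtain ⟨y', hy', hyy'⟩ := exists_dist_lt_of_hausdorffDist_lt hy hlt fin
  have := dist_le_diam_of_mem L.isCompact.isBounded hx' hy'
  have := dist_triangle4 x x' y' y
  rw [dist_comm y y'] at hyy'
  linarith

theorem continuous_diam : Continuous fun K : NonemptyCompacts X => diam (K : Set X) :=
  (LipschitzWith.of_le_add_mul 2 fun K L => by simpa using diam_le_diam_add K L).continuous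

theorem nontrivial_of_diam_pos {s : Set X} (h : 0 < diam s) : s.Nontrivial := by
  rw [← Set.not_subsingleton_iff]
  exact fun hs => h.ne' (diam_subsingleton hs)

/-- The image of a continuum under a homeomorphism. -/
def image (g : X ≃ₜ X) (K : Continua X) : Continua X :=
  ⟨K.1.map g g.continuous, by
    simpa using K.2.image g g.continuous.continuousOn⟩

@[simp] theorem coe_image (g : X ≃ₜ X) (K : Continua X) :
    ((image g K).1 : Set X) = g '' (K.1 : Set X) := rfl

theorem continuous_diam_image (g : X ≃ₜ X) :
    Continuous fun K : Continua X => diam (g '' (K.1 : Set X)) :=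
  (continuous_diam.comp g.continuous.nonemptyCompacts_map).comp continuous_subtype_val

end Hyperspace

section Iterates

theorem coe_pow_eq_iterate (f : X ≃ₜ X) (n : ℕ) : ⇑(f ^ n) = (⇑f)^[n] := by
  induction n with
  | zero => rfl
  | succ n ih => rw [pow_succ, Function.iterate_succ, ← ih]; rfl

theorem zim_eq (f : X ≃ₜ X) (n : ℤ) (A : Set X) : zim f n A = ⇑(f ^ n) '' A := by
  cases n with
  | ofNat n => simp [zim, coe_pow_eq_iterate]
  | negSucc n =>
    rw [zpow_negSucc, ← inv_pow, coe_pow_eq_iterate]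
    rfl

theorem image_zpow_zpow (f : X ≃ₜ X) (m n : ℤ) (A : Set X) :
    ⇑(f ^ m) '' (⇑(f ^ n) '' A) = ⇑(f ^ (m + n)) '' A := by
  rw [zpow_add, image_image]
  rfl

/-- `δ` is a constant of cw-expansivity for `f`. -/
def HasConstant (f : X ≃ₜ X) (δ : ℝ) : Prop :=
  ∀ A : Set X, IsConnected A → A.Nontrivial → ∃ n : ℤ, δ < diam (⇑(f ^ n) '' A)

theorem HasConstant.inv {f : X ≃ₜ X} {δ : ℝ} (h : HasConstant f δ) : HasConstant f⁻¹ δ := by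
  intro A hA hA'
  obtain ⟨n, hn⟩ := h A hA hA'
  exact ⟨-n, by rwa [inv_zpow', neg_neg]⟩

/-- The continua of diameter at least `δ` whose first `m` images under `g` have
diameter at most `δ`. -/
def contracted (g : X ≃ₜ X) (δ : ℝ) (m : ℕ) : Set (Continua X) :=
  {B | (∀ j : ℕ, 1 ≤ j → j ≤ m → diam (⇑(g ^ j) '' (B.1 : Set X)) ≤ δ) ∧ δ ≤ diam (B.1 : Set X)}

theorem contracted_anti (g : X ≃ₜ X) (δ : ℝ) : Antitone (contracted g δ) :=
  fun _ _ hmn _ hB => ⟨fun j h1 h2 => hB.1 j h1 (h2.trans hmn), hB.2⟩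

theorem contracted_nonempty_of_image {f : X ≃ₜ X} {δ : ℝ} {A : Continua X} {n : ℤ} {m : ℕ}
    (hn : δ < diam (⇑(f ^ n) '' (A.1 : Set X)))
    (hlt : ∀ j : ℤ, j.natAbs < n.natAbs → diam (⇑(f ^ j) '' (A.1 : Set X)) ≤ δ)
    (hmn : n < -m) : (contracted f δ m).Nonempty := by
  refine ⟨image (f ^ n) A, fun j h1 h2 => ?_, hn.le⟩
  rw [coe_image, ← zpow_natCast, image_zpow_zpow]
  exact hlt _ (by omega)

variable [CompactSpace X] {f : X ≃ₜ X} {δ : ℝ}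

/-- Uniform cw-expansivity. -/
theorem HasConstant.exists_forall_diam_lt (h : HasConstant f δ) {ε : ℝ} (hε : 0 < ε) :
    ∃ N : ℕ, ∀ K : Continua X,
      (∀ j : ℤ, |j| ≤ N → diam (⇑(f ^ j) '' (K.1 : Set X)) ≤ δ) → diam (K.1 : Set X) < ε := by
  by_contra! H
  let S : ℕ → Set (Continua X) := fun N =>
    {K | (∀ j : ℤ, |j| ≤ N → diam (⇑(f ^ j) '' (K.1 : Set X)) ≤ δ) ∧ ε ≤ diam (K.1 : Set X)}
  have hcl : ∀ N, IsClosed (S N) := fun N => by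
    refine IsClosed.inter (s₁ := {K : Continua X | ∀ j : ℤ, |j| ≤ N → _}) ?_
      (isClosed_le continuous_const (continuous_diam.comp continuous_subtype_val))
    simp only [ofPred_forall]
    exact isClosed_iInter fun j => isClosed_iInter fun _ =>
      isClosed_le (continuous_diam_image _) continuous_const
  obtain ⟨K, hK⟩ := IsCompact.nonempty_iInter_of_sequence_nonempty_isCompact_isClosed S
    (fun N K hK => ⟨fun j hj => hK.1 j (hj.trans (by push_cast; linarith)), hK.2⟩)
    H (hcl 0).isCompact hcl
  rw [mem_iInter] at hK
  obtain ⟨n, hn⟩ := h K.1 K.2 (nontrivial_of_diam_pos (hε.trans_le (hK 0).2))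
  have := (hK n.natAbs).1 n (by simp)
  linarith

theorem HasConstant.mem_Ws (h : HasConstant f δ) {K : Continua X}
    (hK : ∀ n : ℕ, diam (⇑(f ^ n) '' (K.1 : Set X)) ≤ δ) : K ∈ Ws f := by
  refine Metric.tendsto_atTop.2 fun ε hε => ?_
  obtain ⟨N, hN⟩ := h.exists_forall_diam_lt hε
  refine ⟨N, fun n hn => ?_⟩
  rw [Real.dist_0_eq_abs, abs_of_nonneg diam_nonneg, ← coe_pow_eq_iterate]
  refine hN (image (f ^ n) K) fun j hj => ?_
  have hj' := (abs_le.1 hj).1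
  obtain ⟨k, hk⟩ := Int.eq_ofNat_of_zero_le (show 0 ≤ j + n by omega)
  rw [coe_image, ← zpow_natCast, image_zpow_zpow, hk, zpow_natCast]
  exact hK k

theorem HasConstant.exists_nontrivial_mem_Ws (h : HasConstant f δ) (hδ : 0 < δ)
    (hne : ∀ m, (contracted f δ m).Nonempty) :
    ∃ K : Continua X, K ∈ Ws f ∧ (K.1 : Set X).Nontrivial := by
  have hcl : ∀ N, IsClosed (contracted f δ N) := fun N => by
    refine IsClosed.inter (s₁ := {K : Continua X | ∀ j : ℕ, 1 ≤ j → j ≤ N → _}) ?_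
      (isClosed_le continuous_const (continuous_diam.comp continuous_subtype_val))
    simp only [ofPred_forall]
    exact isClosed_iInter fun j => isClosed_iInter fun _ => isClosed_iInter fun _ =>
      isClosed_le (continuous_diam_image _) continuous_const
  obtain ⟨K, hK⟩ := IsCompact.nonempty_iInter_of_sequence_nonempty_isCompact_isClosed _
    (fun N => contracted_anti f δ N.le_succ) hne (hcl 0).isCompact hcl
  rw [mem_iInter] at hK
  refine ⟨image f K, h.mem_Ws fun n => ?_,
    (nontrivial_of_diam_pos (hδ.trans_le (hK 0).2)).image f.injective⟩
  have h1 := (hK (n + 1)).1 (n + 1) (by omega) le_rfl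
  rw [pow_succ] at h1
  rw [coe_image, image_image]
  exact h1

theorem HasConstant.contracted_nonempty_or [ConnectedSpace X] [Nontrivial X]
    (h : HasConstant f δ) (hδ : 0 < δ) (m : ℕ) :
    (contracted f δ m).Nonempty ∨ (contracted f⁻¹ δ m).Nonempty := by
  classical
  obtain ⟨x⟩ := (inferInstance : Nonempty X)
  obtain ⟨C, hCV, hC, hCc, hCn⟩ := exists_nontrivial_subcontinuum_subset (K := univ)
    (V := ⋂ j ∈ Finset.Icc (-m : ℤ) m, ⇑(f ^ j) ⁻¹' ball ((f ^ j) x) (δ / 2))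
    isCompact_univ isConnected_univ nontrivial_univ
    (isOpen_biInter_finset fun j _ => isOpen_ball.preimage (f ^ j).continuous)
    ⟨x, mem_univ _, mem_iInter₂.2 fun j _ => mem_ball_self (half_pos hδ)⟩
  let A : Continua X := ⟨⟨⟨C, hC⟩, hCn.nonempty⟩, hCc⟩
  have hsmall : ∀ j : ℤ, j.natAbs ≤ m → diam (⇑(f ^ j) '' (A.1 : Set X)) ≤ δ := by
    intro j hj
    have hsub : ⇑(f ^ j) '' (A.1 : Set X) ⊆ ball ((f ^ j) x) (δ / 2) := by
      rintro _ ⟨z, hz, rfl⟩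
      exact mem_iInter₂.1 (hCV hz).2 j (Finset.mem_Icc.2 (by omega))
    calc _ ≤ diam (ball ((f ^ j) x) (δ / 2)) := diam_mono hsub isBounded_ball
      _ ≤ 2 * (δ / 2) := diam_ball (half_pos hδ).le
      _ = δ := by ring
  have hex : ∃ k : ℕ, ∃ n : ℤ, n.natAbs = k ∧ δ < diam (⇑(f ^ n) '' (A.1 : Set X)) := by
    obtain ⟨n, hn⟩ := h C hCc hCn
    exact ⟨_, n, rfl, hn⟩
  obtain ⟨n, hnk, hn⟩ := Nat.find_spec hex
  have hlt : ∀ j : ℤ, j.natAbs < n.natAbs → diam (⇑(f ^ j) '' (A.1 : Set X)) ≤ δ := by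
    intro j hj
    rw [hnk] at hj
    by_contra! hcon
    exact Nat.find_min hex hj ⟨j, rfl, hcon⟩
  have hmn : m < n.natAbs := by
    by_contra! hcon
    exact absurd (hsmall n hcon) (not_le.2 hn)
  rcases lt_or_ge n 0 with h0 | h0
  · exact Or.inl (contracted_nonempty_of_image hn hlt (by omega))
  · refine Or.inr (contracted_nonempty_of_image (A := A) (n := -n) ?_ (fun j hj => ?_) (by omega))
    · rwa [inv_zpow', neg_neg]
    · rw [inv_zpow']
      exact hlt _ (by omega)

theorem HasConstant.exists_nontrivial_mem_Ws_or [ConnectedSpace X] [Nontrivial X]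
    (h : HasConstant f δ) (hδ : 0 < δ) :
    ∃ K : Continua X, (K ∈ Ws f ∨ K ∈ Wu f) ∧ (K.1 : Set X).Nontrivial := by
  by_cases h1 : ∀ m, (contracted f δ m).Nonempty
  · obtain ⟨K, hK, hKn⟩ := h.exists_nontrivial_mem_Ws hδ h1
    exact ⟨K, Or.inl hK, hKn⟩
  by_cases h2 : ∀ m, (contracted f⁻¹ δ m).Nonempty
  · obtain ⟨K, hK, hKn⟩ := h.inv.exists_nontrivial_mem_Ws hδ h2
    exact ⟨K, Or.inr hK, hKn⟩
  push Not at h1 h2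
  obtain ⟨m, hm⟩ := h1
  obtain ⟨k, hk⟩ := h2
  rcases h.contracted_nonempty_or hδ (max m k) with h3 | h3
  · exact absurd (h3.mono (contracted_anti f δ (le_max_left m k))) (by simp [hm])
  · exact absurd (h3.mono (contracted_anti f⁻¹ δ (le_max_right m k))) (by simp [hk])

end Iterates

section Mixing

variable [CompactSpace X] {g : X ≃ₜ X}

theorem exists_forall_iterate_symm_inter_nonempty {A : Continua X}
    (hA : Tendsto (fun n : ℕ =>
      hausdorffDist {B : Continua X | (B.1 : Set X) ⊆ (⇑g.symm)^[n] '' (A.1 : Set X)}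
        (closure (Ws g))) atTop (nhds 0)) {V : Set X} (hV : IsOpen V) (hVn : V.Nonempty) :
    ∃ N : ℕ, ∀ n ≥ N, ((⇑g.symm)^[n] '' (A.1 : Set X) ∩ V).Nonempty := by
  obtain ⟨x, hx⟩ := hVn
  obtain ⟨ε, hε, hεV⟩ := Metric.isOpen_iff.1 hV x hx
  obtain ⟨N, hN⟩ := eventually_atTop.1 (hA.eventually_lt_const hε)
  refine ⟨N, fun n hn => ?_⟩
  let P : Continua X := ⟨{x}, by simpa using isConnected_singleton⟩
  have hP : P ∈ closure (Ws g) := subset_closure (by simp [P, Ws])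
  have hself : image (g.symm ^ n) A ∈
      {B : Continua X | (B.1 : Set X) ⊆ (⇑g.symm)^[n] '' (A.1 : Set X)} := by
    simp [coe_pow_eq_iterate]
  obtain ⟨B, hB, hBP⟩ := exists_dist_lt_of_hausdorffDist_lt' hP (hN n hn)
    (hausdorffEDist_ne_top_of_nonempty_of_bounded ⟨_, hself⟩ ⟨_, hP⟩
      (isCompact_univ.isBounded.subset (subset_univ _))
      (isCompact_univ.isBounded.subset (subset_univ _)))
  obtain ⟨b, hb⟩ := B.1.nonempty
  rw [Subtype.dist_eq, NonemptyCompacts.dist_eq] at hBP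
  obtain ⟨x', hx', hlt⟩ := exists_dist_lt_of_hausdorffDist_lt hb hBP
    (hausdorffEDist_ne_top_of_nonempty_of_bounded B.1.nonempty P.1.nonempty
      B.1.isCompact.isBounded P.1.isCompact.isBounded)
  obtain rfl : x' = x := by simpa [P] using hx'
  exact ⟨b, hB hb, hεV hlt⟩

theorem mem_Ws_of_subset_iterate_symm {A C : Continua X} (hA : A ∈ Ws g) {n : ℕ}
    (hC : (C.1 : Set X) ⊆ (⇑g.symm)^[n] '' (A.1 : Set X)) : C ∈ Ws g := by
  refine (tendsto_add_atTop_iff_nat n).1 ?_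
  refine squeeze_zero (fun _ => diam_nonneg) (fun k => ?_) hA
  refine diam_mono ?_ (isCompact_univ.isBounded.subset (subset_univ _))
  rintro _ ⟨z, hz, rfl⟩
  obtain ⟨a, ha, rfl⟩ := hC hz
  refine ⟨a, ha, ?_⟩
  rw [Function.iterate_add_apply, (Function.LeftInverse.iterate g.apply_symm_apply n) a]

theorem exists_forall_inter_nonempty
    (hPA : ∀ A : Continua X, A ∈ Ws g → (A.1 : Set X).Nontrivial →
      Tendsto (fun n : ℕ =>
        hausdorffDist {B : Continua X | (B.1 : Set X) ⊆ (⇑g.symm)^[n] '' (A.1 : Set X)}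
          (closure (Ws g))) atTop (nhds 0))
    {A : Continua X} (hA : A ∈ Ws g) (hAn : (A.1 : Set X).Nontrivial) {U V : Set X}
    (hU : IsOpen U) (hV : IsOpen V) (hUn : U.Nonempty) (hVn : V.Nonempty) :
    ∃ N : ℕ, ∀ n ≥ N, ((⇑g.symm)^[n] '' U ∩ V).Nonempty := by
  obtain ⟨N, hN⟩ := exists_forall_iterate_symm_inter_nonempty (hPA A hA hAn) hU hUn
  have hN' := hN N le_rfl
  rw [← coe_pow_eq_iterate] at hN'
  obtain ⟨C, hCU, hC, hCc, hCn⟩ := exists_nontrivial_subcontinuum_subset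
    (image (g.symm ^ N) A).1.isCompact (image (g.symm ^ N) A).2
    (hAn.image (g.symm ^ N).injective) hU hN'
  let C' : Continua X := ⟨⟨⟨C, hC⟩, hCn.nonempty⟩, hCc⟩
  have hC' : C' ∈ Ws g := mem_Ws_of_subset_iterate_symm hA (n := N) (by
    rw [← coe_pow_eq_iterate]
    exact hCU.trans inter_subset_left)
  obtain ⟨M, hM⟩ := exists_forall_iterate_symm_inter_nonempty (hPA C' hC' hCn) hV hVn
  exact ⟨M, fun n hn => (hM n hn).mono (inter_subset_inter_left _
    (image_mono (hCU.trans inter_subset_right)))⟩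

end Mixing

end CWExpansive

open CWExpansive

/-- A cw-expansive homeomorphism of a continuum satisfying condition (PA)
is topologically mixing. -/
theorem cwExpansive_condPA_topologically_mixing
    [CompactSpace X] [ConnectedSpace X] (f : X ≃ₜ X)
    (hcw : IsCWExpansive f) (hPA : CondPA f) :
    ∀ U V : Set X, IsOpen U → IsOpen V → U.Nonempty → V.Nonempty →
      ∃ N : ℕ, 0 < N ∧ ∀ n ≥ N, (U ∩ (⇑f)^[n] '' V).Nonempty := by
  intro U V hU hV hUn hVn
  suffices ∃ N : ℕ, ∀ n ≥ N, (U ∩ (⇑f)^[n] '' V).Nonempty by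
    obtain ⟨N, hN⟩ := this
    exact ⟨N + 1, N.succ_pos, fun n hn => hN n (by omega)⟩
  rcases subsingleton_or_nontrivial X with hX | hX
  · obtain ⟨u, hu⟩ := hUn
    obtain ⟨v, hv⟩ := hVn
    exact ⟨0, fun n _ => ⟨u, hu, v, hv, Subsingleton.elim _ _⟩⟩
  obtain ⟨δ, hδ, hexp⟩ := hcw
  have hconst : HasConstant f δ := fun A hA hAn => by
    simpa only [zim_eq] using hexp A hA hAn
  obtain ⟨A, hA | hA, hAn⟩ := hconst.exists_nontrivial_mem_Ws_or hδ
  · obtain ⟨N, hN⟩ := exists_forall_inter_nonempty hPA.1 hA hAn hU hV hUn hVn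
    refine ⟨N, fun n hn => ?_⟩
    obtain ⟨_, ⟨u, hu, rfl⟩, hv⟩ := hN n hn
    exact ⟨u, hu, _, hv, (Function.LeftInverse.iterate f.apply_symm_apply n) u⟩
  · obtain ⟨N, hN⟩ := exists_forall_inter_nonempty (g := f.symm) hPA.2 hA hAn hV hU hVn hUn
    exact ⟨N, fun n hn => by rw [inter_comm]; exact hN n hn⟩
end

section
/- Let f be a cw-expansive homeomorphism of a continuum X satisfying condition (PA). Then for every stable continuum Aˢ with more than one point, dist_H(f^{-n}(Aˢ), X) → 0 as n → +∞ (the negative iterates of Aˢ converge to the whole space X in the Hausdorff metric); analogously, for every unstable continuum Aᵘ with more than one point, dist_H(f^{n}(Aᵘ), X) → 0 as n → +∞. -/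
open Metric Set Filter TopologicalSpace

variable {X : Type*} [MetricSpace X]

/-- A one-point set, as a point of the hyperspace of continua. -/
def singletonContinuum (x : X) : Continua X := ⟨{x}, by simp [isConnected_singleton]⟩

theorem coe_singletonContinuum (x : X) : ((singletonContinuum x).1 : Set X) = {x} := by
  simp [singletonContinuum]

theorem singletonContinuum_mem_Ws (f : X ≃ₜ X) (x : X) : singletonContinuum x ∈ Ws f := by
  simp [Ws, coe_singletonContinuum]

/-- If `F` contains all one-point continua, then `T` is at least as close to the whole space
as the family of subcontinua of `T` is to `F`. -/
theorem hausdorffDist_univ_le_hausdorffDist_subcontinua [CompactSpace X] {T : Set X}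
    (hT : T.Nonempty) {F : Set (Continua X)} (hF : ∀ x, singletonContinuum x ∈ F) :
    hausdorffDist T univ ≤ hausdorffDist {B : Continua X | (B.1 : Set X) ⊆ T} F := by
  obtain ⟨t, ht⟩ := hT
  have bdd (S : Set (Continua X)) : Bornology.IsBounded S := by
    obtain ⟨C, hC⟩ := isBounded_iff.1
      (isBounded_of_compactSpace (s := (univ : Set (NonemptyCompacts X))))
    exact isBounded_iff.2 ⟨C, fun _ _ _ _ => hC (mem_univ _) (mem_univ _)⟩
  have fin : hausdorffEDist {B : Continua X | (B.1 : Set X) ⊆ T} F ≠ ⊤ :=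
    hausdorffEDist_ne_top_of_nonempty_of_bounded
      ⟨singletonContinuum t, by simpa [coe_singletonContinuum] using ht⟩
      ⟨_, hF t⟩ (bdd _) (bdd _)
  refine le_of_forall_gt_imp_ge_of_dense fun r hr => ?_
  have hr0 : 0 ≤ r := hausdorffDist_nonneg.trans hr.le
  refine hausdorffDist_le_of_mem_dist hr0 (fun x _ => ⟨x, mem_univ x, by simpa using hr0⟩)
    fun x _ => ?_
  obtain ⟨B, hB, hBx⟩ := exists_dist_lt_of_hausdorffDist_lt' (hF x) hr fin
  have hBx' : hausdorffDist (B.1 : Set X) ((singletonContinuum x).1 : Set X) < r := hBx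
  obtain ⟨y, hy, hyx⟩ := exists_dist_lt_of_hausdorffDist_lt'
    (by simp [coe_singletonContinuum] : x ∈ ((singletonContinuum x).1 : Set X)) hBx'
    (hausdorffEDist_ne_top_of_nonempty_of_bounded B.1.nonempty (singletonContinuum x).1.nonempty
      B.1.isCompact.isBounded (singletonContinuum x).1.isCompact.isBounded)
  exact ⟨y, hB hy, by rw [dist_comm]; exact hyx.le⟩

/-- For a cw-expansive homeomorphism of a continuum satisfying (PA), the negative
iterates of any nontrivial stable continuum converge to the whole space in the
Hausdorff metric, and likewise the positive iterates of any nontrivial unstable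
continuum. -/
theorem iterates_of_stable_continuum_tendsto_whole_space
    [CompactSpace X] [ConnectedSpace X] (f : X ≃ₜ X)
    (hcw : IsCWExpansive f) (hPA : CondPA f) :
    (∀ A : Continua X, A ∈ Ws f → (A.1 : Set X).Nontrivial →
      Tendsto (fun n : ℕ => hausdorffDist ((⇑f.symm)^[n] '' (A.1 : Set X)) (univ : Set X))
        atTop (nhds 0)) ∧
    (∀ A : Continua X, A ∈ Wu f → (A.1 : Set X).Nontrivial →
      Tendsto (fun n : ℕ => hausdorffDist ((⇑f)^[n] '' (A.1 : Set X)) (univ : Set X))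
        atTop (nhds 0)) := by
  refine ⟨fun A hA hnt => ?_, fun A hA hnt => ?_⟩
  · exact squeeze_zero (fun _ => hausdorffDist_nonneg)
      (fun n => hausdorffDist_univ_le_hausdorffDist_subcontinua (A.1.nonempty.image _)
        fun x => subset_closure (singletonContinuum_mem_Ws f x)) (hPA.1 A hA hnt)
  · exact squeeze_zero (fun _ => hausdorffDist_nonneg)
      (fun n => hausdorffDist_univ_le_hausdorffDist_subcontinua (A.1.nonempty.image _)
        fun x => subset_closure (singletonContinuum_mem_Ws f.symm x)) (hPA.2 A hA hnt)
end

section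
/- If X is a continuum (a compact connected metric space) and f : X → X is a cw-expansive homeomorphism, then the set Wˢ_f of stable continua and the set Wᵘ_f of unstable continua are each connected subsets of the hyperspace (C(X), dist_H). -/
open Metric Set Filter TopologicalSpace

variable {X : Type*} [MetricSpace X]

/-- A boundary bumping statement: if `A` is a compact preconnected set, and the component of a
point `m` in the trace on `A` of the closed set `F` is contained in an open set `U ⊆ F`, then
this component is all of `A`. -/
theorem subset_connectedComponentIn_of_subset_isOpen {Y : Type*} [TopologicalSpace Y]
    [T2Space Y] {A F U : Set Y} {m : Y} (hA : IsPreconnected A) (hAc : IsCompact A)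
    (hF : IsClosed F) (hU : IsOpen U) (hUF : U ⊆ F) (hm : m ∈ A ∩ F)
    (h : connectedComponentIn (A ∩ F) m ⊆ U) : A ⊆ connectedComponentIn (A ∩ F) m := by
  have hK : IsCompact (A ∩ F) := hAc.inter_right hF
  have : CompactSpace ↥(A ∩ F) := isCompact_iff_compactSpace.mp hK
  let p : ↥(A ∩ F) := ⟨m, hm⟩
  obtain ⟨D, hD, hmD, hDU⟩ : ∃ D : Set ↥(A ∩ F), IsClopen D ∧ p ∈ D ∧ D ⊆ Subtype.val ⁻¹' U := by
    have : Nonempty { s : Set ↥(A ∩ F) // IsClopen s ∧ p ∈ s } :=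
      ⟨⟨univ, isClopen_univ, mem_univ _⟩⟩
    obtain ⟨D, hD⟩ := exists_subset_nhds_of_compactSpace
      (V := fun s : { s : Set ↥(A ∩ F) // IsClopen s ∧ p ∈ s } => s.1)
      (fun s t => ⟨⟨s.1 ∩ t.1, s.2.1.inter t.2.1, s.2.2, t.2.2⟩,
        inter_subset_left, inter_subset_right⟩)
      (fun s => s.2.1.isClosed) (U := Subtype.val ⁻¹' U) (by
        intro x hx
        refine (hU.preimage continuous_subtype_val).mem_nhds (h ?_)
        rw [← connectedComponent_eq_iInter_isClopen] at hx
        rw [connectedComponentIn_eq_image hm]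
        exact ⟨x, hx, rfl⟩)
    exact ⟨D.1, D.2.1, D.2.2, hD⟩
  obtain ⟨V, hV, rfl⟩ := isOpen_induced_iff.mp hD.isOpen
  have hcl : IsClosed (A ∩ F ∩ V) := by
    have := (hD.isClosed.isCompact.image continuous_subtype_val).isClosed
    rwa [Subtype.image_preimage_coe] at this
  have hsub : A ∩ F ∩ V ⊆ U := fun x hx => hDU (a := ⟨x, hx.1⟩) hx.2
  have hAV : A ⊆ V ∩ U := by
    by_contra hne
    obtain ⟨y, hyA, hy⟩ := not_subset.mp hne
    obtain ⟨x, hxA, ⟨hxV, hxU⟩, hx⟩ := hA (V ∩ U) (A ∩ F ∩ V)ᶜ (hV.inter hU) hcl.isOpen_compl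
      (fun x _ => or_iff_not_imp_right.mpr fun hx =>
        have hx := not_not.mp hx
        ⟨hx.2, hsub hx⟩)
      ⟨m, hm.1, hmD, hsub ⟨hm, hmD⟩⟩ ⟨y, hyA, fun hy' => hy ⟨hy'.2, hsub hy'⟩⟩
    exact hx ⟨⟨hxA, hUF hxU⟩, hxV⟩
  exact hA.subset_connectedComponentIn hm.1 fun x hx => ⟨hx, hUF (hAV hx).2⟩

theorem Continua.dist_le_of_subset_thickening {A B : Continua X} {ε : ℝ} (hε : 0 ≤ ε)
    (hAB : (A.1 : Set X) ⊆ B.1) (hBA : (B.1 : Set X) ⊆ thickening ε (A.1 : Set X)) :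
    dist A B ≤ ε := by
  rw [Subtype.dist_eq, NonemptyCompacts.dist_eq]
  refine hausdorffDist_le_of_mem_dist hε (fun x hx => ⟨x, hAB hx, by simpa using hε⟩)
    fun x hx => ?_
  obtain ⟨z, hz, hxz⟩ := mem_thickening_iff.mp (hBA hx)
  exact ⟨z, hz, hxz.le⟩

/-- A closed family of subcontinua of `A` is closed under upper bounds of chains. -/
theorem Continua.exists_upperBound_of_isChain {A : Continua X} {t c : Set (Continua X)}
    (ht : IsClosed t) (hct : c ⊆ iSet A ∩ t) (hc : IsChain (· ≤ ·) c) (hne : c.Nonempty) :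
    ∃ K ∈ iSet A ∩ t, ∀ B ∈ c, B ≤ K := by
  have : Nonempty c := hne.to_subtype
  let S : Set X := closure (⋃ B : c, (B.1.1 : Set X))
  have hdir : Directed (· ⊆ ·) fun B : c => (B.1.1 : Set X) := fun B C =>
    (hc.total B.2 C.2).elim (fun h => ⟨C, h, subset_rfl⟩) fun h => ⟨B, subset_rfl, h⟩
  have hBS : ∀ B : c, (B.1.1 : Set X) ⊆ S := fun B =>
    (subset_iUnion (fun B : c => (B.1.1 : Set X)) B).trans subset_closure
  have hSA : S ⊆ A.1 :=
    closure_minimal (iUnion_subset fun B => (hct B.2).1) A.1.isCompact.isClosed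
  have hSconn : IsConnected S := by
    refine ⟨(hne.some.1.nonempty).mono (hBS ⟨_, hne.some_mem⟩), IsPreconnected.closure ?_⟩
    rw [← sUnion_range]
    exact IsPreconnected.sUnion_directed hdir.directedOn_range
      (forall_mem_range.mpr fun B => B.1.2.isPreconnected)
  let K : Continua X :=
    ⟨⟨⟨S, A.1.isCompact.of_isClosed_subset isClosed_closure hSA⟩, hSconn.nonempty⟩, hSconn⟩
  refine ⟨K, ⟨hSA, ?_⟩, fun B hB => hBS ⟨B, hB⟩⟩
  refine ht.closure_subset_iff.mpr subset_rfl (Metric.mem_closure_iff.mpr fun ε hε => ?_)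
  obtain ⟨B, hB⟩ := K.1.isCompact.elim_directed_cover
    (fun B : c => thickening (ε / 2) (B.1.1 : Set X)) (fun _ => isOpen_thickening)
    ((closure_subset_thickening (half_pos hε) _).trans (thickening_iUnion _ _).subset)
    (fun B C => (hdir B C).imp fun _ h =>
      ⟨thickening_subset_of_subset _ h.1, thickening_subset_of_subset _ h.2⟩)
  refine ⟨B, (hct B.2).2, ?_⟩
  rw [dist_comm]
  exact (dist_le_of_subset_thickening (half_pos hε).le (hBS B) hB).trans_lt (half_lt_self hε)

/-- A proper subcontinuum can be enlarged inside the ambient continuum by an arbitrarily small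
amount. -/
theorem Continua.exists_lt_dist_lt {A M : Continua X} (hMA : M < A) {ε : ℝ} (hε : 0 < ε) :
    ∃ C ∈ iSet A, M < C ∧ dist M C < ε := by
  obtain ⟨m, hm⟩ := M.1.nonempty
  let F : Set X := cthickening (ε / 3) (M.1 : Set X)
  have hMA' : (M.1 : Set X) ⊆ A.1 := hMA.le
  have hMF : (M.1 : Set X) ⊆ A.1 ∩ F := subset_inter hMA' (self_subset_cthickening _)
  have hcl : IsClosed (connectedComponentIn ((A.1 : Set X) ∩ F) m) :=
    isClosed_of_closure_subset <|
      isPreconnected_connectedComponentIn.closure.subset_connectedComponentIn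
        (subset_closure (mem_connectedComponentIn (hMF hm)))
        (closure_minimal (connectedComponentIn_subset _ _)
          (A.1.isCompact.isClosed.inter isClosed_cthickening))
  have hCA : connectedComponentIn ((A.1 : Set X) ∩ F) m ⊆ A.1 ∩ F :=
    connectedComponentIn_subset _ _
  have hconn : IsConnected (connectedComponentIn ((A.1 : Set X) ∩ F) m) :=
    isConnected_connectedComponentIn_iff.mpr (hMF hm)
  let C : Continua X := ⟨⟨⟨connectedComponentIn ((A.1 : Set X) ∩ F) m,
    A.1.isCompact.of_isClosed_subset hcl (hCA.trans inter_subset_left)⟩, hconn.nonempty⟩, hconn⟩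
  have hMC : M ≤ C := M.2.isPreconnected.subset_connectedComponentIn hm hMF
  refine ⟨C, hCA.trans inter_subset_left, lt_of_le_not_ge hMC fun hCM => ?_, ?_⟩
  · have hAC : A ≤ C := subset_connectedComponentIn_of_subset_isOpen A.2.isPreconnected A.1.isCompact
      isClosed_cthickening isOpen_thickening (thickening_subset_cthickening (ε / 3) _) (hMF hm)
      (Subset.trans hCM (self_subset_thickening (by positivity) _))
    exact hMA.not_ge (hAC.trans hCM)
  · refine (dist_le_of_subset_thickening (half_pos hε).le hMC ?_).trans_lt (half_lt_self hε)
    exact (hCA.trans inter_subset_right).trans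
      (cthickening_subset_thickening' (half_pos hε) (by linarith) _)

/-- The hyperspace of subcontinua of a continuum is connected. -/
theorem Continua.isPreconnected_iSet (A : Continua X) : IsPreconnected (iSet A) := by
  rw [isPreconnected_closed_iff]
  intro t t' ht ht' hcover hne hne'
  by_contra hdisj
  have key : ∀ u u' : Set (Continua X), IsClosed u → IsClosed u' → iSet A ⊆ u ∪ u' →
      ¬ (iSet A ∩ (u ∩ u')).Nonempty → (iSet A ∩ u).Nonempty → A ∈ u := by
    rintro u u' hu hu' huu' hd ⟨B, hB⟩
    obtain ⟨M, -, hM⟩ := zorn_le_nonempty₀ (iSet A ∩ u)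
      (fun c hcu hc y hy => exists_upperBound_of_isChain hu hcu hc ⟨y, hy⟩) B hB
    obtain rfl | hMA := eq_or_lt_of_le (show M ≤ A from hM.prop.1)
    · exact hM.prop.2
    refine (hd ⟨M, hM.prop.1, hM.prop.2, ?_⟩).elim
    refine hu'.closure_subset_iff.mpr subset_rfl (Metric.mem_closure_iff.mpr fun ε hε => ?_)
    obtain ⟨C, hCA, hMC, hd⟩ := exists_lt_dist_lt hMA hε
    exact ⟨C, (huu' hCA).resolve_left fun hCu => hM.not_prop_of_gt hMC ⟨hCA, hCu⟩, hd⟩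
  exact hdisj ⟨A, Subset.rfl, key t t' ht ht' hcover hdisj hne,
    key t' t ht' ht (union_comm t t' ▸ hcover) (inter_comm t t' ▸ hdisj) hne'⟩

theorem iSet_subset_Ws {f : X ≃ₜ X} {A : Continua X} (hA : A ∈ Ws f) : iSet A ⊆ Ws f :=
  fun _ hB => squeeze_zero (fun _ => diam_nonneg)
    (fun n => diam_mono (image_mono hB)
      (A.1.isCompact.image (f.continuous.iterate n)).isBounded) hA

/-- The continuum consisting of a single point. -/
def Continua.point (x : X) : Continua X := ⟨{x}, by simpa using isConnected_singleton⟩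

theorem Continua.continuous_point : Continuous (Continua.point : X → Continua X) :=
  NonemptyCompacts.continuous_singleton.subtype_mk _

theorem Continua.point_mem_Ws (f : X ≃ₜ X) (x : X) : Continua.point x ∈ Ws f := by
  simp [Ws, Continua.point]

theorem isConnected_Ws [ConnectedSpace X] (f : X ≃ₜ X) : IsConnected (Ws f) := by
  obtain ⟨x₀⟩ : Nonempty X := inferInstance
  refine ⟨⟨_, Continua.point_mem_Ws f x₀⟩,
    isPreconnected_of_forall (Continua.point x₀) fun A hA => ?_⟩
  obtain ⟨a, ha⟩ := A.1.nonempty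
  refine ⟨range Continua.point ∪ iSet A,
    union_subset (range_subset_iff.mpr (Continua.point_mem_Ws f)) (iSet_subset_Ws hA),
    Or.inl (mem_range_self x₀), Or.inr Subset.rfl,
    (isPreconnected_range Continua.continuous_point).union (Continua.point a) (mem_range_self a)
      (singleton_subset_iff.mpr ha) (Continua.isPreconnected_iSet A)⟩

/-- For a cw-expansive homeomorphism of a continuum X, the sets Wˢ_f and Wᵘ_f of
stable and unstable continua are connected subsets of the hyperspace (C(X), dist_H). -/
theorem Ws_Wu_connected
    [CompactSpace X] [ConnectedSpace X] (f : X ≃ₜ X) (hcw : IsCWExpansive f) :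
    IsConnected (Ws f) ∧ IsConnected (Wu f) :=
  ⟨isConnected_Ws f, isConnected_Ws f.symm⟩
end

section
/- Let X be a compact metric space and A₁, A₂ ⊆ X continua. If r > 0 is such that for every subcontinuum C ⊆ A₁ there is a subcontinuum D ⊆ A₂ with dist_H(C, D) ≤ r, and for every subcontinuum C ⊆ A₂ there is a subcontinuum D ⊆ A₁ with dist_H(C, D) ≤ r, then dist_H(A₁, A₂) ≤ r. Consequently dist_H(A₁, A₂) ≤ dist_{H̃}(A₁, A₂), where dist_{H̃} denotes the second order Hausdorff distance. -/
open Metric Set Filter TopologicalSpace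

variable {X : Type*} [MetricSpace X]

/-- The two-sided approximation property of Definition 1.1: every subcontinuum of
A₁ is r-close in Hausdorff distance to a subcontinuum of A₂, and conversely. -/
def TwoSided (A₁ A₂ : Continua X) (r : ℝ) : Prop :=
  (∀ C : Continua X, (C.1 : Set X) ⊆ (A₁.1 : Set X) →
    ∃ D : Continua X, (D.1 : Set X) ⊆ (A₂.1 : Set X) ∧
      hausdorffDist (C.1 : Set X) (D.1 : Set X) ≤ r) ∧
  (∀ C : Continua X, (C.1 : Set X) ⊆ (A₂.1 : Set X) →
    ∃ D : Continua X, (D.1 : Set X) ⊆ (A₁.1 : Set X) ∧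
      hausdorffDist (C.1 : Set X) (D.1 : Set X) ≤ r)

/-- The second order Hausdorff distance: the infimum of the r > 0 with the
two-sided approximation property. -/
noncomputable def distTildeH (A₁ A₂ : Continua X) : ℝ :=
  sInf {r : ℝ | 0 < r ∧ TwoSided A₁ A₂ r}

theorem infDist_le_of_exists_hausdorffDist_le {A B : Continua X} {r : ℝ}
    (h : ∃ D : Continua X, (D.1 : Set X) ⊆ (B.1 : Set X) ∧
      hausdorffDist (A.1 : Set X) (D.1 : Set X) ≤ r) {x : X} (hx : x ∈ (A.1 : Set X)) :
    infDist x (B.1 : Set X) ≤ r := by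
  obtain ⟨D, hDB, hD⟩ := h
  have hfin : hausdorffEDist (A.1 : Set X) (D.1 : Set X) ≠ ⊤ :=
    hausdorffEDist_ne_top_of_nonempty_of_bounded A.1.nonempty D.1.nonempty
      A.1.isCompact.isBounded D.1.isCompact.isBounded
  exact (infDist_le_infDist_of_subset hDB D.1.nonempty).trans
    ((infDist_le_hausdorffDist_of_mem hx hfin).trans hD)

theorem TwoSided.hausdorffDist_le {A₁ A₂ : Continua X} {r : ℝ} (hr : 0 ≤ r)
    (h : TwoSided A₁ A₂ r) : hausdorffDist (A₁.1 : Set X) (A₂.1 : Set X) ≤ r :=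
  hausdorffDist_le_of_infDist hr
    (fun _ hx => infDist_le_of_exists_hausdorffDist_le (h.1 A₁ Subset.rfl) hx)
    (fun _ hx => infDist_le_of_exists_hausdorffDist_le (h.2 A₂ Subset.rfl) hx)

theorem hausdorffDist_le_diam_univ [BoundedSpace X] (C D : Continua X) :
    hausdorffDist (C.1 : Set X) (D.1 : Set X) ≤ diam (univ : Set X) :=
  (hausdorffDist_le_diam C.1.nonempty C.1.isCompact.isBounded D.1.nonempty
    D.1.isCompact.isBounded).trans (diam_mono (subset_univ _) (Bornology.IsBounded.all _))

theorem twoSided_of_diam_univ_le [BoundedSpace X] (A₁ A₂ : Continua X) {r : ℝ}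
    (hr : diam (univ : Set X) ≤ r) : TwoSided A₁ A₂ r :=
  ⟨fun C _ => ⟨A₂, Subset.rfl, (hausdorffDist_le_diam_univ C A₂).trans hr⟩,
    fun C _ => ⟨A₁, Subset.rfl, (hausdorffDist_le_diam_univ C A₁).trans hr⟩⟩

/-- If every subcontinuum of A₁ is r-close in Hausdorff distance to a subcontinuum
of A₂ and conversely, then dist_H(A₁, A₂) ≤ r; consequently
dist_H(A₁, A₂) ≤ dist_H̃(A₁, A₂). -/
theorem hausdorffDist_le_of_twoSided [CompactSpace X] (A₁ A₂ : Continua X) :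
    (∀ r : ℝ, 0 < r → TwoSided A₁ A₂ r →
      hausdorffDist (A₁.1 : Set X) (A₂.1 : Set X) ≤ r) ∧
    hausdorffDist (A₁.1 : Set X) (A₂.1 : Set X) ≤ distTildeH A₁ A₂ := by
  refine ⟨fun r hr h => h.hausdorffDist_le hr.le,
    le_csInf ⟨diam (univ : Set X) + 1, ?_, ?_⟩ fun r hr => hr.2.hausdorffDist_le hr.1.le⟩
  · exact add_pos_of_nonneg_of_pos diam_nonneg one_pos
  · exact twoSided_of_diam_univ_le A₁ A₂ (le_add_of_nonneg_right zero_le_one)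
end
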